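/- arXiv:2102.05128 — 6 statements merged into one kernel-verified Lean document; each statement's English description precedes it below -/
import Mathlib

section
/- Let n ≥ 2 and let L₀, …, L_n ∈ ℂ[a,b] be pairwise non-proportional homogeneous linear forms. Then the map ℙ¹ → ℙⁿ sending [a:b] to [L₀(a,b)ⁿ : ⋯ : L_n(a,b)ⁿ] is well defined (the coordinates never all vanish simultaneously for (a,b) ≠ (0,0)), injective, and its image is contained in no hyperplane of ℙⁿ; in particular it parametrizes a nondegenerate rational curve in ℙⁿ. -/
open MvPolynomial

noncomputable section

/-- Binomial expansion of a linear form in two variables, indexed by `Fin (n + 1)`. -/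
lemma linear_pow_eq_sum {R : Type*} [CommSemiring R] (n : ℕ) (α β x y : R) :
    (α * x + β * y) ^ n = ∑ k : Fin (n + 1),
      α ^ k.1 * β ^ k.rev.1 * ((n.choose k.1 : R) * (x ^ k.1 * y ^ k.rev.1)) := by
  rw [add_pow, Finset.sum_range]
  refine Finset.sum_congr rfl fun k _ => ?_
  have hk : k.rev.1 = n - k.1 := by rw [Fin.val_rev]; omega
  rw [hk, mul_pow, mul_pow]
  ring

/-- A projective Vandermonde matrix with pairwise independent rows is nonsingular. -/
lemma det_projVandermonde_ne_zero {K : Type*} [Field K] {m : ℕ} {α β : Fin m → K}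
    (h : ∀ i j, i ≠ j → α i * β j - α j * β i ≠ 0) :
    (Matrix.projVandermonde α β).det ≠ 0 := by
  rw [Matrix.det_projVandermonde]
  refine Finset.prod_ne_zero_iff.mpr fun i _ => Finset.prod_ne_zero_iff.mpr fun j hj => ?_
  exact h j i (Finset.mem_Ioi.mp hj).ne'

/-- If the `n`-th powers of `n + 1` pairwise independent linear forms take proportional values at
two points, then so do all monomials of degree `n`. -/
lemma mul_monomial_eq_of_mul_linear_pow_eq {K : Type*} [Field K] [CharZero K] {n : ℕ}
    {α β : Fin (n + 1) → K} (h : ∀ i j, i ≠ j → α i * β j - α j * β i ≠ 0) {x y x' y' s : K}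
    (heq : ∀ i, s * (α i * x' + β i * y') ^ n = (α i * x + β i * y) ^ n) (k : Fin (n + 1)) :
    s * (x' ^ k.1 * y' ^ k.rev.1) = x ^ k.1 * y ^ k.rev.1 := by
  have hzero := Matrix.eq_zero_of_mulVec_eq_zero (det_projVandermonde_ne_zero h)
    (v := fun k => (n.choose k.1 : K) *
      (s * (x' ^ k.1 * y' ^ k.rev.1) - x ^ k.1 * y ^ k.rev.1)) (by
    ext i
    have hi := heq i
    rw [linear_pow_eq_sum, linear_pow_eq_sum, Finset.mul_sum, ← sub_eq_zero,
      ← Finset.sum_sub_distrib] at hi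
    rw [Pi.zero_apply, ← hi, Matrix.mulVec, dotProduct]
    refine Finset.sum_congr rfl fun k _ => ?_
    rw [Matrix.projVandermonde_apply]
    ring)
  have hchoose : (n.choose k.1 : K) ≠ 0 :=
    Nat.cast_ne_zero.mpr (Nat.choose_pos (Nat.lt_succ_iff.mp k.2)).ne'
  exact sub_eq_zero.mp ((mul_eq_zero.mp (congrFun hzero k)).resolve_left hchoose)

/-- The `n`-th powers of `n + 1` pairwise independent linear forms are linearly independent. -/
lemma eq_zero_of_sum_mul_linear_pow_eq_zero {K : Type*} [Field K] [CharZero K] {n : ℕ}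
    {α β : Fin (n + 1) → K} (h : ∀ i j, i ≠ j → α i * β j - α j * β i ≠ 0)
    {a : Fin (n + 1) → K} (ha : ∀ x : K, ∑ i, a i * (α i * x + β i * 1) ^ n = 0) : a = 0 := by
  have hV : (Matrix.projVandermonde (fun j : Fin (n + 1) => (j.1 : K)) fun _ => 1).det ≠ 0 :=
    det_projVandermonde_ne_zero fun i j hij => by
      simpa [sub_eq_zero, Fin.val_inj] using hij
  refine Matrix.eq_zero_of_vecMul_eq_zero (det_projVandermonde_ne_zero h) ?_
  have hzero := Matrix.eq_zero_of_mulVec_eq_zero hV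
    (v := fun k => (n.choose k.1 : K) * (Matrix.vecMul a (Matrix.projVandermonde α β)) k) (by
    ext j
    rw [Pi.zero_apply, ← ha j.1]
    simp only [linear_pow_eq_sum, Matrix.mulVec, Matrix.vecMul, dotProduct, Finset.mul_sum,
      Matrix.projVandermonde_apply]
    rw [Finset.sum_comm]
    exact Finset.sum_congr rfl fun i _ => Finset.sum_congr rfl fun k _ => by ring)
  ext k
  have hchoose : (n.choose k.1 : K) ≠ 0 :=
    Nat.cast_ne_zero.mpr (Nat.choose_pos (Nat.lt_succ_iff.mp k.2)).ne'
  exact (mul_eq_zero.mp (congrFun hzero k)).resolve_left hchoose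

/-- A binary form of degree one is a combination of the two variables. -/
lemma exists_eq_smul_X_add_smul_X {R : Type*} [CommSemiring R] {p : MvPolynomial (Fin 2) R}
    (hp : p.IsHomogeneous 1) : ∃ α β : R, p = α • X 0 + β • X 1 := by
  have hmem := (mem_homogeneousSubmodule 1 p).mpr hp
  rw [homogeneousSubmodule_one_eq_span_X, Submodule.mem_span_range_iff_exists_fun] at hmem
  obtain ⟨c, hc⟩ := hmem
  exact ⟨c 0, c 1, by rw [← hc, Fin.sum_univ_two]⟩

/-- **The coordinate-wise `n`-th power of a line is a nondegenerate rational curve.**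
Let `n ≥ 2` and let `L₀, …, Lₙ ∈ ℂ[a,b]` be pairwise non-proportional homogeneous linear
forms.  Then the map `ℙ¹ → ℙⁿ` sending `[a:b]` to `[L₀(a,b)ⁿ : ⋯ : Lₙ(a,b)ⁿ]` is well
defined (the coordinates never all vanish simultaneously for `(a,b) ≠ (0,0)`), injective,
and its image is contained in no hyperplane of `ℙⁿ`. -/
theorem coordinatewise_power_of_line_is_rational_normal_curve
    (n : ℕ) (hn : 2 ≤ n) (L : Fin (n + 1) → MvPolynomial (Fin 2) ℂ)
    (hhom : ∀ i, (L i).IsHomogeneous 1) (hne : ∀ i, L i ≠ 0)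
    (hprop : ∀ i j, i ≠ j → ∀ c : ℂ, L i ≠ c • L j) :
    -- the map is well defined
    (∀ v : Fin 2 → ℂ, v ≠ 0 → (fun i => (eval v (L i)) ^ n) ≠ 0) ∧
    -- the induced map on projective spaces is injective
    (∀ (u v : Fin 2 → ℂ) (hu : u ≠ 0) (hv : v ≠ 0)
        (hu' : (fun i => (eval u (L i)) ^ n) ≠ 0) (hv' : (fun i => (eval v (L i)) ^ n) ≠ 0),
      Projectivization.mk ℂ (fun i => (eval u (L i)) ^ n) hu' =
          Projectivization.mk ℂ (fun i => (eval v (L i)) ^ n) hv' →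
        Projectivization.mk ℂ u hu = Projectivization.mk ℂ v hv) ∧
    -- the image lies on no hyperplane
    (∀ a : Fin (n + 1) → ℂ, a ≠ 0 →
      ∃ v : Fin 2 → ℂ, v ≠ 0 ∧ (∑ i, a i * (eval v (L i)) ^ n) ≠ 0) := by
  choose α β hL using fun i => exists_eq_smul_X_add_smul_X (hhom i)
  have heval (v : Fin 2 → ℂ) (i) : eval v (L i) = α i * v 0 + β i * v 1 := by
    simp [hL i, smul_eval]
  have hdet : ∀ i j, i ≠ j → α i * β j - α j * β i ≠ 0 := by
    intro i j hij h0
    by_cases hα : α j = 0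
    · have hβ : β j ≠ 0 := fun hβ => hne j (by simp [hL j, hα, hβ])
      have hαi : α i = 0 := by simpa [hα, hβ] using h0
      refine hprop i j hij (β i / β j) ?_
      rw [hL i, hL j, hα, hαi, zero_smul, zero_add, zero_add, smul_smul,
        div_mul_cancel₀ _ hβ]
    · refine hprop i j hij (α i / α j) ?_
      have hβi : α i / α j * β j = β i := by
        field_simp
        linear_combination h0
      rw [hL i, hL j, smul_add, smul_smul, smul_smul, div_mul_cancel₀ _ hα, hβi]
  simp only [heval]
  refine ⟨fun v hv h => hv ?_, fun u v hu hv hu' hv' h => ?_, fun a ha => ?_⟩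
  · have hzero (i) : α i * v 0 + β i * v 1 = 0 := eq_zero_of_pow_eq_zero (congrFun h i)
    have h01 := hdet 0 (Fin.last n) (by simp [Fin.ext_iff]; omega)
    have h0 := hzero 0
    have h1 := hzero (Fin.last n)
    ext k
    fin_cases k
    · refine (mul_eq_zero.mp (?_ : _ * v 0 = 0)).resolve_left h01
      linear_combination β (Fin.last n) * h0 - β 0 * h1
    · refine (mul_eq_zero.mp (?_ : _ * v 1 = 0)).resolve_left h01
      linear_combination α 0 * h1 - α (Fin.last n) * h0
  · obtain ⟨s, hs⟩ := (Projectivization.mk_eq_mk_iff' ℂ _ _ hu' hv').mp h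
    obtain ⟨m, rfl⟩ : ∃ m, n = m + 1 := ⟨n - 1, by omega⟩
    have hmono := mul_monomial_eq_of_mul_linear_pow_eq hdet (congrFun hs)
    have h0 : s * v 1 ^ (m + 1) = u 1 ^ (m + 1) := by simpa using hmono 0
    have h1 : s * (v 0 * v 1 ^ m) = u 0 * u 1 ^ m := by simpa using hmono 1
    have hlast : s * v 0 ^ (m + 1) = u 0 ^ (m + 1) := by simpa using hmono (Fin.last (m + 1))
    have hs0 : s ≠ 0 := by
      rintro rfl
      refine hu' ?_
      rw [← hs, zero_smul]
    rw [Projectivization.mk_eq_mk_iff']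
    by_cases hu1 : u 1 = 0
    · have hv1 : v 1 = 0 := by simpa [hu1, hs0] using h0
      have hv0 : v 0 ≠ 0 := fun hv0 => hv (by ext k; fin_cases k <;> simp [hv0, hv1])
      refine ⟨u 0 / v 0, ?_⟩
      ext k
      fin_cases k <;> simp [hu1, hv1, hv0]
    · have hv1 : v 1 ≠ 0 := fun hv1 => hu1 (by simpa [hv1] using h0.symm)
      refine ⟨u 1 / v 1, ?_⟩
      have hcross : u 1 * v 0 = u 0 * v 1 := by
        refine mul_left_cancel₀ (pow_ne_zero m hu1) ?_
        linear_combination v 1 * h1 - v 0 * h0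
      ext k
      fin_cases k
      · simp only [Pi.smul_apply, smul_eq_mul, Fin.zero_eta]
        field_simp
        linear_combination hcross
      · simp [hv1]
  · by_contra! hall
    refine ha (eq_zero_of_sum_mul_linear_pow_eq_zero hdet fun x => ?_)
    simpa using hall ![x, 1] fun hx => one_ne_zero (congrFun hx 1)

end
end

section
/- Let α, β ∈ ℂ with α ≠ 0 and β ≠ 0, and let ℓ ⊂ ℙ² be the line defined by αx + βy − z = 0. Then the coordinate-wise square ℓ^{∘2} = { Q⋆Q : Q ∈ ℓ } is exactly the zero locus in ℙ² of the quadratic form (α²x + β²y − z)² − 4α²β²xy. -/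
open MvPolynomial

noncomputable section

abbrev P2 : Type := Projectivization ℂ (Fin 3 → ℂ)

/-- A line in `ℙ²`: the zero locus of a nonzero linear form. -/
def IsLine (L : Set P2) : Prop :=
  ∃ a : Fin 3 → ℂ, a ≠ 0 ∧ L = {p : P2 | (∑ i, a i * p.rep i) = 0}

/-- An irreducible conic in `ℙ²`: the zero locus of an irreducible homogeneous quadratic form. -/
def IsIrredConic (γ : Set P2) : Prop :=
  ∃ q : MvPolynomial (Fin 3) ℂ, q.IsHomogeneous 2 ∧ Irreducible q ∧
    γ = {p : P2 | eval p.rep q = 0}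

/-- `L` is tangent to `γ` : their intersection is a single point. -/
def IsTangent (L γ : Set P2) : Prop := ∃ p : P2, L ∩ γ = {p}

/-- The star configuration defined by a family of lines: the set of points lying on at
least two of the lines. -/
def starConfig {r : ℕ} (L : Fin r → Set P2) : Set P2 :=
  {p : P2 | ∃ i j : Fin r, i ≠ j ∧ p ∈ L i ∧ p ∈ L j}

/-- A family of lines meets properly: they are distinct lines, no three concurrent. -/
def MeetsProperly {r : ℕ} (L : Fin r → Set P2) : Prop :=
  (∀ i, IsLine (L i)) ∧ Function.Injective L ∧
    ∀ (p : P2) (i j k : Fin r), p ∈ L i → p ∈ L j → p ∈ L k → i = j ∨ i = k ∨ j = k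

/-- `W` is a complete intersection of type `(a,b)`. -/
def IsCI (W : Set P2) (a b : ℕ) : Prop :=
  ∃ F G : MvPolynomial (Fin 3) ℂ, F ≠ 0 ∧ G ≠ 0 ∧
    F.IsHomogeneous a ∧ G.IsHomogeneous b ∧
    {p : P2 | eval p.rep F = 0 ∧ eval p.rep G = 0} = W ∧ W.ncard = a * b

/-- The `ℂ`-submodule of polynomials vanishing at every point of `W`. -/
def vanishingSubmodule (W : Set P2) : Submodule ℂ (MvPolynomial (Fin 3) ℂ) where
  carrier := {F : MvPolynomial (Fin 3) ℂ | ∀ p ∈ W, eval p.rep F = 0}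
  add_mem' := by
    intro a b ha hb p hp
    simp only [map_add, ha p hp, hb p hp, add_zero]
  zero_mem' := by
    intro p hp
    simp
  smul_mem' := by
    intro c F hF p hp
    simp only [smul_eval, hF p hp, mul_zero]

/-- The degree-`d` graded component of the vanishing ideal of `W`. -/
def idealComp (W : Set P2) (d : ℕ) : Submodule ℂ (MvPolynomial (Fin 3) ℂ) :=
  homogeneousSubmodule (Fin 3) ℂ d ⊓ vanishingSubmodule W

/-- The Hilbert function of `W ⊆ ℙ²`. -/
def HF (W : Set P2) (d : ℕ) : ℤ :=
  (Module.finrank ℂ ↥(homogeneousSubmodule (Fin 3) ℂ d) : ℤ) -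
    (Module.finrank ℂ ↥(idealComp W d) : ℤ)

/-- The h-vector of `W ⊆ ℙ²`. -/
def hvec (W : Set P2) : ℕ → ℤ
  | 0 => HF W 0
  | d + 1 => HF W (d + 1) - HF W d

/-- The (affine cone) ideal of a point of `ℙ²`; its powers cut out fat points. -/
def pointIdeal (p : P2) : Ideal (MvPolynomial (Fin 3) ℂ) := RingHom.ker (eval p.rep)

/-- The degree-`d` graded component of a homogeneous ideal `I`. -/
def idealCompI (I : Ideal (MvPolynomial (Fin 3) ℂ)) (d : ℕ) :
    Submodule ℂ (MvPolynomial (Fin 3) ℂ) :=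
  homogeneousSubmodule (Fin 3) ℂ d ⊓ Submodule.restrictScalars ℂ I

/-- The Hilbert function of `S/I`. -/
def HFI (I : Ideal (MvPolynomial (Fin 3) ℂ)) (d : ℕ) : ℤ :=
  (Module.finrank ℂ ↥(homogeneousSubmodule (Fin 3) ℂ d) : ℤ) -
    (Module.finrank ℂ ↥(idealCompI I d) : ℤ)

/-- The h-vector of `S/I`. -/
def hvecI (I : Ideal (MvPolynomial (Fin 3) ℂ)) : ℕ → ℤ
  | 0 => HFI I 0
  | d + 1 => HFI I (d + 1) - HFI I d

/-- The Hadamard-product relation: `R = P ⋆ Q`. -/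
def hadRel (P Q R : P2) : Prop :=
  ∃ (u v : Fin 3 → ℂ) (hu : u ≠ 0) (hv : v ≠ 0) (huv : (fun i => u i * v i) ≠ 0),
    Projectivization.mk ℂ u hu = P ∧ Projectivization.mk ℂ v hv = Q ∧
      Projectivization.mk ℂ (fun i => u i * v i) huv = R

/-- `Δ₀`: points of `ℙ²` with at most one nonzero coordinate. -/
def Δ₀ : Set P2 := {p : P2 | ∃ i : Fin 3, ∀ j : Fin 3, j ≠ i → p.rep j = 0}

/-- If `mk u = p` then `u` is a scalar multiple of the chosen representative of `p`. -/
theorem exists_eq_mul_rep {u : Fin 3 → ℂ} (hu : u ≠ 0) {p : P2}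
    (h : Projectivization.mk ℂ u hu = p) : ∃ a : ℂ, ∀ i, u i = a * p.rep i := by
  rw [← p.mk_rep, Projectivization.mk_eq_mk_iff'] at h
  obtain ⟨a, rfl⟩ := h
  exact ⟨a, fun i => rfl⟩

/-- The representative of `mk u` is a scalar multiple of `u`. -/
theorem exists_rep_eq_mul {u : Fin 3 → ℂ} (hu : u ≠ 0) {p : P2}
    (h : Projectivization.mk ℂ u hu = p) : ∃ a : ℂ, ∀ i, p.rep i = a * u i := by
  rw [← p.mk_rep, eq_comm, Projectivization.mk_eq_mk_iff'] at h
  obtain ⟨a, ha⟩ := h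
  exact ⟨a, fun i => (congrFun ha i).symm⟩

/-- A solution of `(α²x + β²y - z)² = 4α²β²xy` is the coordinate-wise square of a vector
on the line `αx + βy = z`. -/
theorem exists_sq_eq_of_conic {α β x y z : ℂ}
    (h : (α ^ 2 * x + β ^ 2 * y - z) ^ 2 - 4 * α ^ 2 * β ^ 2 * (x * y) = 0) :
    ∃ s t : ℂ, s * s = x ∧ t * t = y ∧ (α * s + β * t) * (α * s + β * t) = z := by
  obtain ⟨s, rfl⟩ := IsAlgClosed.exists_eq_mul_self x
  obtain ⟨t, rfl⟩ := IsAlgClosed.exists_eq_mul_self y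
  have hf : ((α * s + β * t) * (α * s + β * t) - z) *
      ((α * s - β * t) * (α * s - β * t) - z) = 0 := by
    linear_combination h
  rcases mul_eq_zero.mp hf with h | h
  · exact ⟨s, t, rfl, rfl, by linear_combination h⟩
  · exact ⟨s, -t, rfl, by ring, by linear_combination h⟩

/-- **The coordinate-wise square of a line is an explicit conic.**
Let `α, β ∈ ℂ` be nonzero and let `ℓ ⊂ ℙ²` be the line `αx + βy − z = 0`.  Then the
coordinate-wise square `ℓ^{∘2} = { Q⋆Q : Q ∈ ℓ }` is exactly the zero locus of the
quadratic form `(α²x + β²y − z)² − 4α²β²xy`. -/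
theorem coordinatewise_square_of_line_eq_conic (α β : ℂ) (hα : α ≠ 0) (hβ : β ≠ 0) :
    {R : P2 | ∃ Q ∈ {p : P2 | α * p.rep 0 + β * p.rep 1 - p.rep 2 = 0}, hadRel Q Q R} =
      {p : P2 | eval p.rep
        ((C (α ^ 2) * X 0 + C (β ^ 2) * X 1 - X 2) ^ 2
          - C (4 * α ^ 2 * β ^ 2) * (X 0 * X 1)) = 0} := by
  ext R
  simp only [Set.mem_ofPred_eq, map_sub, map_pow, map_add, map_mul, eval_C, eval_X]
  constructor
  · rintro ⟨Q, hQ, u, v, hu, hv, huv, hPu, hPv, hR⟩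
    obtain ⟨a, ha⟩ := exists_eq_mul_rep hu hPu
    obtain ⟨b, hb⟩ := exists_eq_mul_rep hv hPv
    obtain ⟨c, hc⟩ := exists_rep_eq_mul huv hR
    have hz : Q.rep 2 = α * Q.rep 0 + β * Q.rep 1 := by linear_combination -hQ
    simp only [hc, ha, hb, hz]
    ring
  · intro h
    obtain ⟨s, t, hs, ht, hst⟩ := exists_sq_eq_of_conic h
    let u : Fin 3 → ℂ := ![s, t, α * s + β * t]
    have huu : (fun i => u i * u i) = R.rep := by
      ext i
      fin_cases i
      · exact hs
      · exact ht
      · exact hst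
    have huv : (fun i => u i * u i) ≠ 0 := huu ▸ R.rep_nonzero
    have hu : u ≠ 0 := by
      intro h0
      exact huv (by ext i; simp [h0])
    refine ⟨Projectivization.mk ℂ u hu, ?_, u, u, hu, hu, huv, rfl, rfl, ?_⟩
    · obtain ⟨a, ha⟩ := exists_rep_eq_mul hu rfl
      have hu2 : u 2 = α * u 0 + β * u 1 := rfl
      linear_combination α * ha 0 + β * ha 1 - ha 2 - a * hu2
    · simp only [huu, Projectivization.mk_rep]
end
end

section
/- Let ℓ ⊂ ℙ² be a line with ℓ ∩ Δ₀ = ∅ and let P ∈ ℓ. Then P⋆ℓ = { P⋆Q : Q ∈ ℓ } is a line in ℙ², and (P⋆ℓ) ∩ ℓ^{∘2} = { P⋆P }; that is, P⋆ℓ meets the conic ℓ^{∘2} only at the point P⋆P, so it is the tangent line to ℓ^{∘2} at P⋆P. -/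
open MvPolynomial

noncomputable section

/-- The canonical representative of the point spanned by `v` is a nonzero multiple of `v`. -/
lemma exists_rep_mk_eq (v : Fin 3 → ℂ) (hv : v ≠ 0) :
    ∃ s : ℂ, s ≠ 0 ∧ ∀ i, (Projectivization.mk ℂ v hv).rep i = s * v i := by
  obtain ⟨s, hs⟩ := Projectivization.exists_smul_eq_mk_rep ℂ v hv
  exact ⟨s, s.ne_zero, fun i => by rw [← hs]; rfl⟩

lemma exists_rep_ne_zero (p : P2) : ∃ i, p.rep i ≠ 0 :=
  Function.ne_iff.mp p.rep_nonzero

lemma hadRel_iff (P Q R : P2) :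
    hadRel P Q R ↔ ∃ t : ℂ, ∀ i, R.rep i = t * (P.rep i * Q.rep i) := by
  constructor
  · rintro ⟨u, v, hu, hv, huv, rfl, rfl, rfl⟩
    obtain ⟨s, hs, hs'⟩ := exists_rep_mk_eq u hu
    obtain ⟨s₂, hs₂, hs₂'⟩ := exists_rep_mk_eq v hv
    obtain ⟨s₃, -, hs₃'⟩ := exists_rep_mk_eq _ huv
    refine ⟨s₃ / (s * s₂), fun i => ?_⟩
    rw [hs', hs₂', hs₃']
    field_simp
  · rintro ⟨t, ht⟩
    have huv : (fun i => P.rep i * Q.rep i) ≠ 0 := by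
      obtain ⟨i, hi⟩ := exists_rep_ne_zero R
      exact Function.ne_iff.mpr ⟨i, fun h => hi (by rw [ht i]; simpa using Or.inr h)⟩
    refine ⟨P.rep, Q.rep, P.rep_nonzero, Q.rep_nonzero, huv, P.mk_rep, Q.mk_rep, ?_⟩
    conv_rhs => rw [← R.mk_rep]
    rw [eq_comm, Projectivization.mk_eq_mk_iff']
    exact ⟨t, funext fun i => (ht i).symm⟩

/-- The coefficients of the line `P ⋆ ℓ`, for `ℓ` with coefficients `a` and `P` represented
by `p`. -/
def hadamardLineCoeff (a p : Fin 3 → ℂ) : Fin 3 → ℂ :=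
  ![a 0 * (p 1 * p 2), a 1 * (p 0 * p 2), a 2 * (p 0 * p 1)]

lemma hadamardLineCoeff_sum_mul (a p q : Fin 3 → ℂ) :
    ∑ i, hadamardLineCoeff a p i * (p i * q i) = p 0 * p 1 * p 2 * ∑ i, a i * q i := by
  simp only [hadamardLineCoeff, Fin.sum_univ_three, Matrix.cons_val]
  ring

lemma exists_eq_mul_of_hadamardLineCoeff {a p r : Fin 3 → ℂ} (ha : ∀ i, a i ≠ 0)
    (hp : ∀ i, ∃ j, j ≠ i ∧ p j ≠ 0) (hr : ∑ i, hadamardLineCoeff a p i * r i = 0) :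
    ∃ q : Fin 3 → ℂ, ∑ i, a i * q i = 0 ∧ ∀ i, r i = p i * q i := by
  have h01 : p 0 ≠ 0 ∨ p 1 ≠ 0 := by simpa [Fin.exists_fin_succ] using hp 2
  have h02 : p 0 ≠ 0 ∨ p 2 ≠ 0 := by simpa [Fin.exists_fin_succ] using hp 1
  have h12 : p 1 ≠ 0 ∨ p 2 ≠ 0 := by simpa [Fin.exists_fin_succ] using hp 0
  have ha0 := ha 0
  have ha1 := ha 1
  have ha2 := ha 2
  simp only [hadamardLineCoeff, Fin.sum_univ_three, Matrix.cons_val] at hr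
  simp only [Fin.sum_univ_three, Fin.forall_fin_succ]
  by_cases h0 : p 0 = 0
  · have h1 : p 1 ≠ 0 := by tauto
    have h2 : p 2 ≠ 0 := by tauto
    have hr0 : r 0 = 0 := by simpa [h0, ha0, h1, h2] using hr
    refine ⟨![-(a 1 * (r 1 / p 1) + a 2 * (r 2 / p 2)) / a 0, r 1 / p 1, r 2 / p 2], ?_, ?_⟩
    · simp; field_simp; ring
    · simp [h0, hr0]; constructor <;> field_simp
  by_cases h1 : p 1 = 0
  · have h2 : p 2 ≠ 0 := by tauto
    have hr1 : r 1 = 0 := by simpa [h0, ha1, h1, h2] using hr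
    refine ⟨![r 0 / p 0, -(a 0 * (r 0 / p 0) + a 2 * (r 2 / p 2)) / a 1, r 2 / p 2], ?_, ?_⟩
    · simp; field_simp; ring
    · simp [h1, hr1]; constructor <;> field_simp
  by_cases h2 : p 2 = 0
  · have hr2 : r 2 = 0 := by simpa [h0, ha2, h1, h2] using hr
    refine ⟨![r 0 / p 0, r 1 / p 1, -(a 0 * (r 0 / p 0) + a 1 * (r 1 / p 1)) / a 2], ?_, ?_⟩
    · simp; field_simp; ring
    · simp [h2, hr2]; constructor <;> field_simp
  · refine ⟨![r 0 / p 0, r 1 / p 1, r 2 / p 2], ?_, ?_⟩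
    · simp; field_simp; linear_combination hr
    · simp; refine ⟨?_, ?_, ?_⟩ <;> field_simp

/-- A point `q` of the line with coefficients `a` whose square lies on `P ⋆ ℓ` is a multiple
of `p`. -/
lemma exists_eq_mul_of_sq_mem {a p q : Fin 3 → ℂ} (ha : ∀ i, a i ≠ 0) (hp0 : ∃ i, p i ≠ 0)
    (hp : ∑ i, a i * p i = 0) (hq : ∑ i, a i * q i = 0)
    (h : ∑ i, hadamardLineCoeff a p i * (q i * q i) = 0) :
    ∃ k : ℂ, ∀ i, q i = k * p i := by
  have ha0 := ha 0
  have ha1 := ha 1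
  have ha2 := ha 2
  simp only [hadamardLineCoeff, Fin.sum_univ_three, Matrix.cons_val] at h hp hq
  set c₀ := p 1 * q 2 - p 2 * q 1 with hc₀
  set c₁ := p 2 * q 0 - p 0 * q 2 with hc₁
  set c₂ := p 0 * q 1 - p 1 * q 0 with hc₂
  have h01 : c₀ * a 1 = c₁ * a 0 := by
    linear_combination q 2 * hp - p 2 * hq
  have h02 : c₀ * a 2 = c₂ * a 0 := by
    linear_combination p 1 * hq - q 1 * hp
  have hprod : a 0 * (c₀ * c₁ * c₂) = 0 := by
    have key : c₀ * (p 1 * p 2) * q 0 ^ 2 + c₁ * (p 0 * p 2) * q 1 ^ 2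
        + c₂ * (p 0 * p 1) * q 2 ^ 2 = - (c₀ * c₁ * c₂) := by
      simp only [hc₀, hc₁, hc₂]; ring
    linear_combination a 0 * key - c₀ * h + p 0 * p 2 * q 1 ^ 2 * h01
      + p 0 * p 1 * q 2 ^ 2 * h02
  have hz : c₀ = 0 ∧ c₁ = 0 ∧ c₂ = 0 := by
    have : c₀ = 0 ∨ c₁ = 0 ∨ c₂ = 0 := by simpa [ha0, or_assoc] using hprod
    have hc : c₀ = 0 := by
      rcases this with h | h | h
      · exact h
      · simpa [h, ha1] using h01
      · simpa [h, ha2] using h02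
    rw [hc] at h01 h02
    exact ⟨hc, by simpa [ha0] using h01.symm, by simpa [ha0] using h02.symm⟩
  obtain ⟨z₀, z₁, z₂⟩ := hz
  rw [hc₀] at z₀
  rw [hc₁] at z₁
  rw [hc₂] at z₂
  obtain ⟨i, hi⟩ := hp0
  refine ⟨q i / p i, fun j => ?_⟩
  rw [div_mul_eq_mul_div, eq_div_iff hi]
  fin_cases i <;> fin_cases j <;> simp <;> grind

/-- **`P⋆ℓ` is the tangent line to `ℓ^{∘2}` at `P⋆P`.**
Let `ℓ ⊂ ℙ²` be a line with `ℓ ∩ Δ₀ = ∅` and let `P ∈ ℓ`.  Then `P⋆ℓ` is a line in `ℙ²`,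
and `(P⋆ℓ) ∩ ℓ^{∘2} = {P⋆P}`: the line `P⋆ℓ` meets the conic `ℓ^{∘2}` only at `P⋆P`. -/
theorem hadamard_tangent_line (L : Set P2) (hL : IsLine L) (hΔ : L ∩ Δ₀ = ∅)
    (P : P2) (hP : P ∈ L) :
    IsLine {R : P2 | ∃ Q ∈ L, hadRel P Q R} ∧
    {R : P2 | ∃ Q ∈ L, hadRel P Q R} ∩ {R : P2 | ∃ Q ∈ L, hadRel Q Q R} =
      {R : P2 | hadRel P P R} := by
  obtain ⟨a, ha, rfl⟩ := hL
  have notMem : ∀ p : P2, ∑ i, a i * p.rep i = 0 → ∀ i, ∃ j, j ≠ i ∧ p.rep j ≠ 0 := by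
    intro p hp i
    by_contra! h
    exact (hΔ.subset ⟨hp, i, h⟩).elim
  have ha' : ∀ i, a i ≠ 0 := by
    intro i hi
    have hne : (Pi.single i 1 : Fin 3 → ℂ) ≠ 0 := by simp
    obtain ⟨s, -, hs⟩ := exists_rep_mk_eq _ hne
    obtain ⟨j, hj, hj'⟩ := notMem (.mk ℂ _ hne) (by simp [hs, Pi.single_apply, hi]) i
    exact hj' (by simp [hs, hj])
  have hPL : ∑ i, a i * P.rep i = 0 := hP
  have hp := notMem P hPL
  have hline : {R : P2 | ∃ Q ∈ {p : P2 | ∑ i, a i * p.rep i = 0}, hadRel P Q R} =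
      {R : P2 | ∑ i, hadamardLineCoeff a P.rep i * R.rep i = 0} := by
    ext R
    simp only [Set.mem_ofPred_eq, hadRel_iff]
    constructor
    · rintro ⟨Q, hQ, t, ht⟩
      simp only [ht, mul_left_comm _ t, ← Finset.mul_sum, hadamardLineCoeff_sum_mul, hQ, mul_zero]
    · intro hR
      obtain ⟨q, hq, hrq⟩ := exists_eq_mul_of_hadamardLineCoeff ha' hp hR
      have hq0 : q ≠ 0 := by
        rintro rfl
        obtain ⟨i, hi⟩ := exists_rep_ne_zero R
        exact hi (by simp [hrq])
      obtain ⟨s, hs, hs'⟩ := exists_rep_mk_eq q hq0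
      refine ⟨.mk ℂ q hq0, ?_, s⁻¹, fun i => ?_⟩
      · simp only [hs', mul_left_comm _ s, ← Finset.mul_sum, hq, mul_zero]
      · rw [hrq, hs']
        field_simp
  refine ⟨⟨hadamardLineCoeff a P.rep, fun h0 => ?_, hline⟩, ?_⟩
  · have e0 := congrFun h0 0
    have e1 := congrFun h0 1
    have e2 := congrFun h0 2
    simp [hadamardLineCoeff, ha'] at e0 e1 e2
    have h01 := hp 2
    have h02 := hp 1
    have h12 := hp 0
    simp [Fin.exists_fin_succ] at h01 h02 h12
    tauto
  · apply Set.Subset.antisymm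
    · rintro R ⟨hR, Q, hQ, hQR⟩
      rw [hline] at hR
      simp only [Set.mem_ofPred_eq, hadRel_iff] at hR hQ hQR ⊢
      obtain ⟨t, ht⟩ := hQR
      have ht0 : t ≠ 0 := by
        rintro rfl
        obtain ⟨i, hi⟩ := exists_rep_ne_zero R
        exact hi (by simp [ht])
      simp only [ht, mul_left_comm _ t, ← Finset.mul_sum] at hR
      obtain ⟨k, hk⟩ := exists_eq_mul_of_sq_mem ha' (exists_rep_ne_zero P) hPL hQ
        ((mul_eq_zero.mp hR).resolve_left ht0)
      exact ⟨t * k ^ 2, fun i => by rw [ht, hk]; ring⟩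
    · exact fun R hR => ⟨⟨P, hP, hR⟩, ⟨P, hP, hR⟩⟩
end
end

section
/- Let ℓ ⊂ ℙ² be a line with ℓ ∩ Δ₀ = ∅ and let P, Q ∈ ℓ be distinct points. Then (P⋆ℓ) ∩ (Q⋆ℓ) = { P⋆Q }; that is, the two lines P⋆ℓ and Q⋆ℓ meet exactly in the Hadamard product point P⋆Q. -/
open MvPolynomial

noncomputable section

/-- Two nonzero vectors whose `2 × 2` minors vanish represent the same point. -/
lemma mk_eq_mk_of_minors {K ι : Type*} [Field K] {u v : ι → K} (hu : u ≠ 0) (hv : v ≠ 0)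
    (h : ∀ i j, u i * v j = u j * v i) :
    Projectivization.mk K u hu = Projectivization.mk K v hv := by
  obtain ⟨i, hi⟩ := Function.ne_iff.mp hv
  simp only [Pi.zero_apply] at hi
  rw [Projectivization.mk_eq_mk_iff']
  refine ⟨u i / v i, funext fun j => ?_⟩
  rw [Pi.smul_apply, smul_eq_mul, div_mul_eq_mul_div, div_eq_iff hi]
  exact h i j

lemma exists_rep_mk_eq_s4 {K ι : Type*} [Field K] {u : ι → K} (hu : u ≠ 0) :
    ∃ c : K, c ≠ 0 ∧ ∀ i, (Projectivization.mk K u hu).rep i = c * u i := by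
  obtain ⟨c, hc⟩ := Projectivization.exists_smul_eq_mk_rep K u hu
  exact ⟨c, c.ne_zero, fun i => by rw [← hc]; rfl⟩

lemma sum_mul_rep_mk_eq_zero_iff {K ι : Type*} [Field K] [Fintype ι] (a : ι → K) {u : ι → K}
    (hu : u ≠ 0) :
    ∑ i, a i * (Projectivization.mk K u hu).rep i = 0 ↔ ∑ i, a i * u i = 0 := by
  obtain ⟨c, hc, h⟩ := exists_rep_mk_eq_s4 hu
  simp only [h, mul_left_comm _ c, ← Finset.mul_sum, mul_eq_zero, hc, false_or]

/-- A line that misses `Δ₀` has only nonzero coefficients. -/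
lemma coeff_ne_zero_of_inter_Δ₀ {a : Fin 3 → ℂ}
    (h : {p : P2 | (∑ i, a i * p.rep i) = 0} ∩ Δ₀ = ∅) (i : Fin 3) : a i ≠ 0 := by
  intro ha
  have hs : (Pi.single i 1 : Fin 3 → ℂ) ≠ 0 := by simp
  obtain ⟨c, -, hc⟩ := exists_rep_mk_eq_s4 hs
  have hmem : Projectivization.mk ℂ _ hs ∈
      {p : P2 | (∑ i, a i * p.rep i) = 0} ∩ Δ₀ := by
    refine ⟨(sum_mul_rep_mk_eq_zero_iff a hs).mpr ?_, i, fun j hj => ?_⟩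
    · simp [Pi.single_apply, ha]
    · simp [hc, hj]
  simp [h] at hmem

/-- For vectors orthogonal to `a`, all minors are proportional to the entries of `a`. -/
lemma exists_minors_eq {K : Type*} [Field K] {a u v : Fin 3 → K} (ha : a 2 ≠ 0)
    (hu : ∑ i, a i * u i = 0) (hv : ∑ i, a i * v i = 0) :
    ∃ t, u 0 * v 1 - u 1 * v 0 = t * a 2 ∧ u 1 * v 2 - u 2 * v 1 = t * a 0 ∧
      u 2 * v 0 - u 0 * v 2 = t * a 1 := by
  rw [Fin.sum_univ_three] at hu hv
  refine ⟨(u 0 * v 1 - u 1 * v 0) / a 2, ?_, ?_, ?_⟩ <;> field_simp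
  · linear_combination u 1 * hv - v 1 * hu
  · linear_combination v 0 * hu - u 0 * hv

/-- If `p, q` are independent and `p, q, v, w` are orthogonal to a vector with nonzero entries,
then `p v = c q w` coordinatewise forces `v` to be proportional to `q`. -/
lemma minors_eq_of_hadamard_eq {K : Type*} [Field K] {a p q v w : Fin 3 → K}
    (ha : ∀ i, a i ≠ 0) (hp : ∑ i, a i * p i = 0) (hq : ∑ i, a i * q i = 0)
    (hv : ∑ i, a i * v i = 0) (hw : ∑ i, a i * w i = 0)
    (hpq : ¬ ∀ i j, p i * q j = p j * q i) {c : K}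
    (h : ∀ i, p i * v i = c * (q i * w i)) :
    ∀ i j, v i * q j = v j * q i := by
  have all_minors : ∀ {x y : Fin 3 → K}, x 0 * y 1 - x 1 * y 0 = 0 →
      x 1 * y 2 - x 2 * y 1 = 0 → x 2 * y 0 - x 0 * y 2 = 0 →
      ∀ i j, x i * y j = x j * y i := by
    intro x y h₀ h₁ h₂ i j
    fin_cases i <;> fin_cases j <;> simp <;> grind
  obtain ⟨t, t₂, t₀, t₁⟩ := exists_minors_eq (ha 2) hp hq
  obtain ⟨s, s₂, s₀, s₁⟩ := exists_minors_eq (ha 2) hv hq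
  have ht : t ≠ 0 := by
    rintro rfl
    exact hpq (all_minors (by simpa using t₂) (by simpa using t₀) (by simpa using t₁))
  suffices hs : s = 0 by
    subst hs
    exact all_minors (by simpa using s₂) (by simpa using s₀) (by simpa using s₁)
  have span : ∀ {x : Fin 3 → K}, ∑ i, a i * x i = 0 →
      ∃ α β, ∀ i, x i = α * p i + β * q i := by
    intro x hx
    have hM : p 0 * q 1 - p 1 * q 0 ≠ 0 := t₂ ▸ mul_ne_zero ht (ha 2)
    refine ⟨(x 0 * q 1 - x 1 * q 0) / (p 0 * q 1 - p 1 * q 0),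
      (p 0 * x 1 - p 1 * x 0) / (p 0 * q 1 - p 1 * q 0), fun i => ?_⟩
    rw [Fin.sum_univ_three] at hp hq hx
    rw [div_mul_eq_mul_div, div_mul_eq_mul_div, ← add_div, eq_div_iff hM]
    fin_cases i <;> simp only [Fin.zero_eta, Fin.mk_one, Fin.reduceFinMk]
    · ring
    · ring
    · apply mul_left_cancel₀ (ha 2)
      linear_combination (p 0 * q 1 - p 1 * q 0) * hx - (x 0 * q 1 - x 1 * q 0) * hp
        - (p 0 * x 1 - p 1 * x 0) * hq
  obtain ⟨α, β, hαβ⟩ := span hv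
  obtain ⟨γ, δ, hγδ⟩ := span hw
  have e : ∀ i, α * p i ^ 2 + (β - c * γ) * (p i * q i) - c * δ * q i ^ 2 = 0 := by
    intro i
    have := h i
    rw [hαβ, hγδ] at this
    linear_combination this
  have vandermonde : α * ((p 0 * q 1 - p 1 * q 0) * (p 1 * q 2 - p 2 * q 1)
      * (p 2 * q 0 - p 0 * q 2)) = 0 := by
    linear_combination -(q 1 * q 2 * (p 1 * q 2 - p 2 * q 1)) * e 0
      - (q 2 * q 0 * (p 2 * q 0 - p 0 * q 2)) * e 1
      - (q 0 * q 1 * (p 0 * q 1 - p 1 * q 0)) * e 2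
  have hα : α = 0 := by
    rw [t₂, t₀, t₁] at vandermonde
    simpa [ht, ha] using vandermonde
  rw [hαβ 0, hαβ 1, hα] at s₂
  have : s * a 2 = 0 := by linear_combination -s₂
  simpa [ha] using this

lemma hadRel.symm {P Q R : P2} (h : hadRel P Q R) : hadRel Q P R := by
  obtain ⟨u, v, hu, hv, huv, hP, hQ, hR⟩ := h
  simp only [mul_comm (u _)] at huv hR
  exact ⟨v, u, hv, hu, huv, hQ, hP, hR⟩

/-- **The tangent lines `P⋆ℓ` and `Q⋆ℓ` meet exactly in `P⋆Q`.**
Let `ℓ ⊂ ℙ²` be a line with `ℓ ∩ Δ₀ = ∅` and let `P, Q ∈ ℓ` be distinct.  Then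
`(P⋆ℓ) ∩ (Q⋆ℓ) = {P⋆Q}`. -/
theorem hadamard_tangent_lines_meet (L : Set P2) (hL : IsLine L) (hΔ : L ∩ Δ₀ = ∅)
    (P Q : P2) (hP : P ∈ L) (hQ : Q ∈ L) (hPQ : P ≠ Q) :
    {R : P2 | ∃ Q' ∈ L, hadRel P Q' R} ∩ {R : P2 | ∃ P' ∈ L, hadRel Q P' R} =
      {R : P2 | hadRel P Q R} := by
  obtain ⟨a, -, rfl⟩ := hL
  have ha := coeff_ne_zero_of_inter_Δ₀ hΔ
  ext R
  constructor
  · rintro ⟨⟨Q', hQ', p, v, hp, hv, hpv, rfl, rfl, rfl⟩, P', hP', q, w, hq, hw, hqw, rfl, rfl, hR⟩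
    refine ⟨p, v, hp, hv, hpv, rfl, ?_, rfl⟩
    obtain ⟨c, hc⟩ := (Projectivization.mk_eq_mk_iff' ℂ _ _ hpv hqw).mp hR.symm
    refine mk_eq_mk_of_minors hv hq (minors_eq_of_hadamard_eq (c := c) ha
      ((sum_mul_rep_mk_eq_zero_iff a hp).mp hP) ((sum_mul_rep_mk_eq_zero_iff a hq).mp hQ)
      ((sum_mul_rep_mk_eq_zero_iff a hv).mp hQ') ((sum_mul_rep_mk_eq_zero_iff a hw).mp hP')
      (fun h => hPQ (mk_eq_mk_of_minors hp hq h)) fun i => ?_)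
    exact (congrFun hc i).symm
  · exact fun h => ⟨⟨Q, hQ, h⟩, P, hP, h.symm⟩
end
end

section
/- Let γ ⊂ ℙ² be an irreducible conic, let r ≥ 3, and let ℓ₁,…,ℓ_r, m₁,…,m_{r−1} be pairwise distinct lines all tangent to γ. Let X = 𝕊(ℓ₁,…,ℓ_r) and Y = 𝕊(m₁,…,m_{r−1}) be the corresponding contact star configurations on γ. Then there exists an irreducible homogeneous form of degree r−1 in ℂ[x,y,z] vanishing at every point of X ∪ Y. -/
open MvPolynomial

noncomputable section

/-! ### Linear forms -/

/-- The linear form with coefficient vector `a`. -/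
def linForm {n : ℕ} (a : Fin n → ℂ) : MvPolynomial (Fin n) ℂ := ∑ i, C (a i) * X i

lemma eval_linForm {n : ℕ} (a v : Fin n → ℂ) : eval v (linForm a) = ∑ i, a i * v i := by
  simp [linForm]

lemma isHomogeneous_linForm {n : ℕ} (a : Fin n → ℂ) : (linForm a).IsHomogeneous 1 :=
  IsHomogeneous.sum _ _ _ fun i _ => isHomogeneous_C_mul_X (a i) i

lemma coeff_linForm {n : ℕ} (a : Fin n → ℂ) (i : Fin n) :
    (linForm a).coeff (Finsupp.single i 1) = a i := by
  classical
  rw [linForm, coeff_sum, Finset.sum_eq_single i]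
  · simp
  · intro j _ hj
    simp [coeff_C_mul, coeff_X, Finsupp.single_left_inj, hj]
  · simp

lemma linForm_ne_zero {n : ℕ} {a : Fin n → ℂ} (ha : a ≠ 0) : linForm a ≠ 0 := by
  obtain ⟨i, hi⟩ := Function.ne_iff.mp ha
  intro h
  exact hi (by simpa [h] using (coeff_linForm a i).symm)

lemma not_isUnit_linForm {n : ℕ} (a : Fin n → ℂ) : ¬ IsUnit (linForm a) := by
  intro h
  have := h.map (eval (0 : Fin n → ℂ))
  rw [eval_linForm] at this
  simp at this

lemma prime_linForm {n : ℕ} {a : Fin n → ℂ} (ha : a ≠ 0) : Prime (linForm a) := by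
  obtain ⟨i, hi⟩ := Function.ne_iff.mp ha
  refine (irreducible_of_totalDegree_eq_one
    ((isHomogeneous_linForm a).totalDegree (linForm_ne_zero ha)) fun x hx => ?_).prime
  have := hx (Finsupp.single i 1)
  rw [coeff_linForm] at this
  exact isUnit_of_dvd_unit this (IsUnit.mk0 _ hi)

lemma eval_aeval {m n : ℕ} (x : Fin n → ℂ) (f : Fin m → MvPolynomial (Fin n) ℂ)
    (G : MvPolynomial (Fin m) ℂ) :
    eval x (aeval f G) = eval (fun k => eval x (f k)) G := by
  have h : (aeval x).comp (aeval f) = aeval (R := ℂ) fun k => eval x (f k) := by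
    refine MvPolynomial.algHom_ext fun k => ?_
    simp
  simpa [coe_aeval_eq_eval] using congrArg (fun φ => φ G) h

/-- A polynomial vanishing on the hyperplane with equation `linForm a` is a multiple of it. -/
lemma linForm_dvd {n : ℕ} {a : Fin n → ℂ} (ha : a ≠ 0) (D : MvPolynomial (Fin n) ℂ)
    (h : ∀ v : Fin n → ℂ, ∑ i, a i * v i = 0 → eval v D = 0) : linForm a ∣ D := by
  classical
  obtain ⟨j, hj⟩ := Function.ne_iff.mp ha
  simp only [Pi.zero_apply] at hj
  let s : Fin n → MvPolynomial (Fin n) ℂ :=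
    fun k => X k - C (if k = j then (a j)⁻¹ else 0) * linForm a
  have hs : aeval s D = 0 := by
    refine MvPolynomial.funext fun v => ?_
    rw [map_zero, eval_aeval]
    apply h
    simp only [s, map_sub, eval_X, map_mul, eval_linForm, eval_C, mul_sub,
      Finset.sum_sub_distrib]
    rw [Finset.sum_eq_single (a := j) (f := fun i => a i * (_ * _))]
    · simp [hj]
    · intro k _ hk
      simp [hk]
    · simp
  have hq : (Ideal.Quotient.mkₐ ℂ (Ideal.span {linForm a})).comp (aeval s) =
      Ideal.Quotient.mkₐ ℂ (Ideal.span {linForm a}) := by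
    refine MvPolynomial.algHom_ext fun k => ?_
    simp only [AlgHom.comp_apply, aeval_X, s, map_sub, map_mul, sub_eq_self]
    rw [Ideal.Quotient.mkₐ_eq_mk, Ideal.Quotient.eq_zero_iff_mem.mpr
      (Ideal.mem_span_singleton_self _), mul_zero]
  have := congrArg (fun f => f D) hq
  simp only [AlgHom.comp_apply, hs, map_zero] at this
  exact Ideal.mem_span_singleton.mp (Ideal.Quotient.eq_zero_iff_mem.mp this.symm)

/-! ### The plane as the symmetric square of a line -/

/-- The determinant of two vectors of `ℂ²`. -/
def br (u w : ℂ × ℂ) : ℂ := u.1 * w.2 - w.1 * u.2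

lemma br_self (u : ℂ × ℂ) : br u u = 0 := by simp [br]

lemma br_swap (u w : ℂ × ℂ) : br w u = - br u w := by simp [br]

lemma br_comb (α β : ℂ) (x y w : ℂ × ℂ) :
    br (α • x + β • y) w = α * br x w + β * br y w := by
  simp [br]; ring

lemma exists_comb_of_br_ne_zero {u w : ℂ × ℂ} (h : br u w ≠ 0) (x : ℂ × ℂ) :
    ∃ α β : ℂ, x = α • u + β • w := by
  refine ⟨br x w / br u w, br u x / br u w, ?_⟩
  ext
  · simp only [Prod.fst_add, Prod.smul_fst, smul_eq_mul]
    field_simp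
    simp [br]; ring
  · simp only [Prod.snd_add, Prod.smul_snd, smul_eq_mul]
    field_simp
    simp [br]; ring

lemma exists_smul_of_br_eq_zero {u w : ℂ × ℂ} (hu : u ≠ 0) (h : br u w = 0) :
    ∃ c : ℂ, w = c • u := by
  have h' : u.1 * w.2 = w.1 * u.2 := sub_eq_zero.mp h
  by_cases h1 : u.1 = 0
  · have h2 : u.2 ≠ 0 := fun h2 => hu (Prod.ext h1 h2)
    refine ⟨w.2 / u.2, Prod.ext ?_ ?_⟩
    · simp only [Prod.smul_fst, smul_eq_mul]; field_simp; linear_combination -h'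
    · simp only [Prod.smul_snd, smul_eq_mul]; field_simp
  · refine ⟨w.1 / u.1, Prod.ext ?_ ?_⟩
    · simp only [Prod.smul_fst, smul_eq_mul]; field_simp
    · simp only [Prod.smul_snd, smul_eq_mul]; field_simp; linear_combination h'

section TangentLines

variable (N : (Fin 3 → ℂ) ≃ₗ[ℂ] (Fin 3 → ℂ))

/-- In the coordinates `N` in which the conic is `z² = x y`, the coefficient vector of the
tangent line with parameter `w`. -/
def tangentVec (w : ℂ × ℂ) : Fin 3 → ℂ := fun i =>
  w.1 ^ 2 * N (Pi.single i 1) 0 + w.2 ^ 2 * N (Pi.single i 1) 1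
    - 2 * w.1 * w.2 * N (Pi.single i 1) 2

lemma sum_tangentVec (w : ℂ × ℂ) (v : Fin 3 → ℂ) :
    ∑ i, tangentVec N w i * v i =
      w.1 ^ 2 * N v 0 + w.2 ^ 2 * N v 1 - 2 * w.1 * w.2 * N v 2 := by
  have h : ∀ k, N v k = ∑ i, v i * N (Pi.single i 1) k := fun k => by
    conv_lhs => rw [pi_eq_sum_univ' v, map_sum]
    simp [Finset.sum_apply]
  simp only [h, tangentVec, Fin.sum_univ_three]
  ring

/-- A vector representing the intersection point of the tangent lines with parameters
`u` and `w`. -/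
def tangentPt (u w : ℂ × ℂ) : Fin 3 → ℂ :=
  N.symm ![u.2 * w.2, u.1 * w.1, (u.1 * w.2 + w.1 * u.2) / 2]

lemma tangentPt_comm (u w : ℂ × ℂ) : tangentPt N u w = tangentPt N w u := by
  simp only [tangentPt]
  congr 1
  ext i; fin_cases i <;> simp <;> ring

lemma tangentPt_comb (u x y : ℂ × ℂ) (α β : ℂ) :
    tangentPt N u (α • x + β • y) = α • tangentPt N u x + β • tangentPt N u y := by
  simp only [tangentPt]
  rw [← map_smul, ← map_smul, ← map_add]
  congr 1
  ext i; fin_cases i <;> simp <;> ring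

lemma eval_tangent (w u x : ℂ × ℂ) :
    eval (tangentPt N u x) (linForm (tangentVec N w)) = br w u * br w x := by
  rw [eval_linForm, sum_tangentVec]
  simp [tangentPt, br]
  ring

lemma exists_eq_tangentPt {w : ℂ × ℂ} (hw : w ≠ 0) {v : Fin 3 → ℂ}
    (h : ∑ i, tangentVec N w i * v i = 0) : ∃ x, v = tangentPt N w x := by
  rw [sum_tangentVec] at h
  have key : ∀ x : ℂ × ℂ, N v = ![w.2 * x.2, w.1 * x.1, (w.1 * x.2 + x.1 * w.2) / 2] →
      v = tangentPt N w x := fun x hx => by rw [tangentPt, ← hx, N.symm_apply_apply]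
  by_cases h1 : w.1 = 0
  · have h2 : w.2 ≠ 0 := fun h2 => hw (Prod.ext h1 h2)
    refine ⟨((2 * N v 2 - N v 0 / w.2 * w.1) / w.2, N v 0 / w.2), key _ ?_⟩
    ext i; fin_cases i
    · simp; field_simp
    · simp; field_simp; linear_combination h
    · simp; field_simp; ring
  · refine ⟨(N v 1 / w.1, (2 * N v 2 - N v 1 / w.1 * w.2) / w.1), key _ ?_⟩
    ext i; fin_cases i
    · simp; field_simp; linear_combination h
    · simp; field_simp
    · simp; field_simp; ring

lemma tangentVec_ne_zero {w : ℂ × ℂ} (hw : w ≠ 0) : tangentVec N w ≠ 0 := by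
  intro h
  have h' : ∀ x, br w x * br w x = 0 := fun x => by
    rw [← eval_tangent N w x x, eval_linForm, h]; simp
  have h1 := h' (1, 0)
  have h2 := h' (0, 1)
  simp [br] at h1 h2
  exact hw (Prod.ext h2 h1)

/-- A polynomial of degree less than the number of given tangent lines, vanishing on all of
them, is zero. -/
lemma eq_zero_of_vanish_tangents {ι : Type*} [Fintype ι] {a : ι → ℂ × ℂ} (ha0 : ∀ i, a i ≠ 0)
    (ha : Pairwise fun i j => br (a i) (a j) ≠ 0) {D : MvPolynomial (Fin 3) ℂ}
    (hdeg : D.totalDegree < Fintype.card ι)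
    (h : ∀ i x, eval (tangentPt N (a i) x) D = 0) : D = 0 := by
  by_contra hD
  have hp := fun i => prime_linForm (tangentVec_ne_zero N (ha0 i))
  have hdvd : ∏ i, linForm (tangentVec N (a i)) ∣ D := by
    apply Finset.prod_dvd_of_isRelPrime
    · intro i _ j _ hij
      refine (hp i).irreducible.isRelPrime_iff_not_dvd.mpr fun ⟨Q, hQ⟩ => ?_
      have := congrArg (eval (tangentPt N (a i) (a i))) hQ
      rw [map_mul, eval_tangent, eval_tangent, br_self, zero_mul, zero_mul, mul_self_eq_zero]
        at this
      exact ha hij.symm this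
    · intro i _
      refine linForm_dvd (tangentVec_ne_zero N (ha0 i)) D fun v hv => ?_
      obtain ⟨x, rfl⟩ := exists_eq_tangentPt N (ha0 i) hv
      exact h i x
  obtain ⟨Q, rfl⟩ := hdvd
  have h1 := left_ne_zero_of_mul hD
  rw [totalDegree_mul_of_isDomain h1 (right_ne_zero_of_mul hD),
    (IsHomogeneous.prod Finset.univ _ (fun _ => 1)
      fun i _ => isHomogeneous_linForm (tangentVec N (a i))).totalDegree h1] at hdeg
  simp at hdeg

/-- Restriction of a polynomial to the tangent line with parameter `u`. -/
def restr (u : ℂ × ℂ) : MvPolynomial (Fin 3) ℂ →ₐ[ℂ] MvPolynomial (Fin 2) ℂ :=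
  aeval fun k => linForm ![tangentPt N u (1, 0) k, tangentPt N u (0, 1) k]

lemma eval_restr (u : ℂ × ℂ) (x : Fin 2 → ℂ) (G : MvPolynomial (Fin 3) ℂ) :
    eval x (restr N u G) = eval (tangentPt N u (x 0, x 1)) G := by
  have hx : ((x 0, x 1) : ℂ × ℂ) = x 0 • (1, 0) + x 1 • (0, 1) := by simp
  rw [restr, eval_aeval, hx, tangentPt_comb]
  congr 2
  ext k
  simp [eval_linForm]
  ring

/-- The binary linear form `br w`. -/
def brForm (w : ℂ × ℂ) : MvPolynomial (Fin 2) ℂ := linForm ![-w.2, w.1]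

lemma eval_brForm (w : ℂ × ℂ) (x : Fin 2 → ℂ) : eval x (brForm w) = br w (x 0, x 1) := by
  simp [brForm, eval_linForm, br]; ring

lemma prime_brForm {w : ℂ × ℂ} (hw : w ≠ 0) : Prime (brForm w) := by
  refine prime_linForm fun h => hw ?_
  have h0 := congrFun h 0
  have h1 := congrFun h 1
  simp at h0 h1
  exact Prod.ext h1 h0

lemma restr_tangent (u w : ℂ × ℂ) :
    restr N u (linForm (tangentVec N w)) = C (br w u) * brForm w := by
  refine MvPolynomial.funext fun x => ?_
  rw [eval_restr, eval_tangent, map_mul, eval_C, eval_brForm]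

lemma exists_associated_subprod_of_dvd_prod {ι R : Type*} [DecidableEq ι] [CommRing R] [IsDomain R]
    {p : ι → R} {s : Finset ι} (hp : ∀ i ∈ s, Prime (p i)) {g : R} (hg : g ∣ ∏ i ∈ s, p i) :
    ∃ t ⊆ s, Associated g (∏ i ∈ t, p i) := by
  induction s using Finset.induction_on generalizing g with
  | empty =>
    exact ⟨∅, Finset.Subset.refl _, by
      simpa [associated_one_iff_isUnit, isUnit_iff_dvd_one] using hg⟩
  | insert j s hj ih =>
    rw [Finset.prod_insert hj] at hg
    have hpj := hp j (Finset.mem_insert_self j s)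
    have ih := fun {g} => ih (g := g) fun i hi => hp i (Finset.mem_insert_of_mem hi)
    by_cases h : p j ∣ g
    · obtain ⟨g, rfl⟩ := h
      obtain ⟨t, ht, hgt⟩ := ih ((mul_dvd_mul_iff_left hpj.ne_zero).mp hg)
      refine ⟨insert j t, Finset.insert_subset_insert j ht, ?_⟩
      rw [Finset.prod_insert fun h => hj (ht h)]
      exact hgt.mul_left _
    · obtain ⟨q, hq⟩ := hg
      obtain ⟨q, rfl⟩ := (hpj.dvd_or_dvd ⟨_, hq.symm⟩).resolve_left h
      obtain ⟨t, ht, hgt⟩ := ih (g := g) ⟨q, mul_left_cancel₀ hpj.ne_zero (by rw [hq]; ring)⟩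
      exact ⟨t, ht.trans (Finset.subset_insert j s), hgt⟩

section BinaryForms

variable {ι : Type*} {a : ι → ℂ × ℂ} {s : Finset ι}

/-- The coordinate vector in `Fin 2 → ℂ` of a pair. -/
def toVec (w : ℂ × ℂ) : Fin 2 → ℂ := ![w.1, w.2]

lemma eval_toVec_brForm (u w : ℂ × ℂ) : eval (toVec w) (brForm u) = br u w := by
  simp [eval_brForm, toVec]

lemma eval_toVec_prod_ne_zero (ha : Pairwise fun i j => br (a i) (a j) ≠ 0) {k : ι}
    (hk : k ∉ s) : eval (toVec (a k)) (∏ l ∈ s, brForm (a l)) ≠ 0 := by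
  rw [eval_prod, Finset.prod_ne_zero_iff]
  intro l hl
  rw [eval_toVec_brForm]
  exact ha fun h => hk (h ▸ hl)

/-- A divisor of a product of distinct binary linear forms is determined up to a constant by
its zeros. -/
lemma eq_C_mul_prod_of_mul_eq [DecidableEq ι] (ha0 : ∀ i, a i ≠ 0)
    (ha : Pairwise fun i j => br (a i) (a j) ≠ 0) {g h : MvPolynomial (Fin 2) ℂ} {e : ℂ}
    (he : e ≠ 0) (hgh : g * h = C e * ∏ k ∈ s, brForm (a k)) :
    ∃ c : ℂ, c ≠ 0 ∧ g = C c * ∏ k ∈ s with eval (toVec (a k)) g = 0, brForm (a k) := by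
  have hu : IsUnit (C e : MvPolynomial (Fin 2) ℂ) := (IsUnit.mk0 e he).map C
  obtain ⟨t, ht, hgt⟩ := exists_associated_subprod_of_dvd_prod
    (fun i _ => prime_brForm (ha0 i)) (hu.dvd_mul_left.mp (Dvd.intro h hgh))
  obtain ⟨v, hv⟩ := hgt.symm
  obtain ⟨c, hc, hvc⟩ := isUnit_iff_eq_C_of_isReduced.mp v.isUnit
  rw [hvc, mul_comm] at hv
  have hts : s.filter (fun k => eval (toVec (a k)) g = 0) = t := by
    ext k
    rw [Finset.mem_filter, ← hv, map_mul, eval_C, mul_eq_zero, or_iff_right hc.ne_zero]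
    constructor
    · rintro ⟨_, h0⟩
      by_contra hk
      exact eval_toVec_prod_ne_zero ha hk h0
    · intro hk
      refine ⟨ht hk, ?_⟩
      rw [eval_prod]
      exact Finset.prod_eq_zero hk (by rw [eval_toVec_brForm, br_self])
  exact ⟨c, hc.ne_zero, by rw [hts, hv]⟩

lemma not_eval_eq_zero_and_of_mul_eq [DecidableEq ι] (ha0 : ∀ i, a i ≠ 0)
    (ha : Pairwise fun i j => br (a i) (a j) ≠ 0) {g h : MvPolynomial (Fin 2) ℂ} {e : ℂ}
    (he : e ≠ 0) (hgh : g * h = C e * ∏ k ∈ s, brForm (a k)) {k : ι} (hk : k ∈ s) :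
    ¬ (eval (toVec (a k)) g = 0 ∧ eval (toVec (a k)) h = 0) := by
  rintro ⟨hg, hh⟩
  have dvd : ∀ {g h : MvPolynomial (Fin 2) ℂ}, g * h = C e * ∏ k ∈ s, brForm (a k) →
      eval (toVec (a k)) g = 0 → brForm (a k) ∣ g := by
    intro g h hgh hg
    obtain ⟨c, -, hc⟩ := eq_C_mul_prod_of_mul_eq ha0 ha he hgh
    rw [hc]
    exact (Finset.dvd_prod_of_mem (fun k => brForm (a k))
      (Finset.mem_filter.mpr ⟨hk, hg⟩)).mul_left _
  obtain ⟨g', rfl⟩ := dvd hgh hg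
  obtain ⟨h', rfl⟩ := dvd (by rw [mul_comm]; exact hgh) hh
  rw [← Finset.mul_prod_erase s (fun k => brForm (a k)) hk] at hgh
  have hcancel : g' * (brForm (a k) * h') = C e * ∏ l ∈ s.erase k, brForm (a l) := by
    refine mul_left_cancel₀ (prime_brForm (ha0 k)).ne_zero ?_
    linear_combination hgh
  have := congrArg (eval (toVec (a k))) hcancel
  rw [map_mul, map_mul, map_mul, eval_toVec_brForm, br_self, eval_C] at this
  simp only [zero_mul, mul_zero] at this
  exact mul_ne_zero he (eval_toVec_prod_ne_zero ha (Finset.notMem_erase k s)) this.symm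

end BinaryForms

lemma infinite_setOf_br_ne_zero {ι : Type*} [Finite ι] {a : ι → ℂ × ℂ} (ha0 : ∀ i, a i ≠ 0) :
    {τ : ℂ | ∀ i, br (1, τ) (a i) ≠ 0}.Infinite := by
  have hfin : (⋃ i, {τ : ℂ | br (1, τ) (a i) = 0}).Finite := by
    refine Set.finite_iUnion fun i => Set.Subsingleton.finite fun τ hτ τ' hτ' => ?_
    simp only [Set.mem_ofPred_eq, br, one_mul] at hτ hτ'
    by_contra hne
    have h1 : (a i).1 = 0 := by
      refine (mul_eq_zero.mp (?_ : (a i).1 * (τ - τ') = 0)).resolve_right (sub_ne_zero.mpr hne)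
      linear_combination hτ' - hτ
    rw [h1] at hτ
    exact ha0 i (Prod.ext h1 (by simpa using hτ))
  refine hfin.infinite_compl.mono fun τ hτ => ?_
  simpa using hτ

section Pencil

variable {ι : Type*} [Fintype ι] [DecidableEq ι] (a : ι → ℂ × ℂ) (κ : ι → ℂ)

/-- The pencil, parametrised by `c`, of linear combinations of the products of all but one of
the given tangent lines. -/
def pencilForm (c : ℂ × ℂ) : MvPolynomial (Fin 3) ℂ :=
  ∑ i, C (κ i * br c (a i)) * ∏ k ∈ Finset.univ.erase i, linForm (tangentVec N (a k))

lemma isHomogeneous_pencilForm (c : ℂ × ℂ) :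
    (pencilForm N a κ c).IsHomogeneous (Fintype.card ι - 1) := by
  refine IsHomogeneous.sum _ _ _ fun i _ => ?_
  have := (isHomogeneous_C (Fin 3) (κ i * br c (a i))).mul
    (IsHomogeneous.prod (Finset.univ.erase i) _ (fun _ => 1)
      fun k _ => isHomogeneous_linForm (tangentVec N (a k)))
  simpa [Finset.card_erase_of_mem] using this

lemma pencilForm_comb (α β : ℂ) (x y : ℂ × ℂ) :
    pencilForm N a κ (α • x + β • y) =
      C α * pencilForm N a κ x + C β * pencilForm N a κ y := by
  simp only [pencilForm, Finset.mul_sum, ← Finset.sum_add_distrib]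
  refine Finset.sum_congr rfl fun i _ => ?_
  rw [br_comb]
  simp only [map_mul, map_add]
  ring

lemma eval_pencilForm_of_mem_two (c : ℂ × ℂ) {v : Fin 3 → ℂ} {i j : ι} (hij : i ≠ j)
    (hi : eval v (linForm (tangentVec N (a i))) = 0)
    (hj : eval v (linForm (tangentVec N (a j))) = 0) : eval v (pencilForm N a κ c) = 0 := by
  rw [pencilForm, map_sum]
  refine Finset.sum_eq_zero fun k _ => ?_
  rw [map_mul, eval_prod]
  by_cases hk : k = i
  · rw [Finset.prod_eq_zero (i := j) (by simp [hk, hij.symm]) hj, mul_zero]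
  · rw [Finset.prod_eq_zero (i := i) (by simp [Ne.symm hk]) hi, mul_zero]

lemma restr_pencilForm (c : ℂ × ℂ) (i : ι) :
    restr N (a i) (pencilForm N a κ c) =
      C (κ i * br c (a i) * ∏ k ∈ Finset.univ.erase i, br (a k) (a i)) *
        ∏ k ∈ Finset.univ.erase i, brForm (a k) := by
  rw [pencilForm, map_sum, Finset.sum_eq_single i]
  · rw [map_mul, map_prod, algHom_C]
    simp only [restr_tangent, Finset.prod_mul_distrib, map_mul, map_prod, algebraMap_eq]
    ring
  · intro k _ hk
    rw [map_mul, map_prod, Finset.prod_eq_zero (i := i) (by simp [hk.symm]), mul_zero]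
    rw [restr_tangent, br_self, map_zero, zero_mul]
  · simp

/-- At the parameter of one of the lines, the form in the pencil is divisible by that line. -/
lemma pencilForm_self (i : ι) :
    ∃ E, pencilForm N a κ (a i) = linForm (tangentVec N (a i)) * E ∧
      ∀ j ≠ i, eval (tangentPt N (a i) (a j)) E =
        κ j * br (a i) (a j) *
          ∏ k ∈ (Finset.univ.erase j).erase i, br (a k) (a i) * br (a k) (a j) := by
  refine ⟨∑ j ∈ Finset.univ.erase i, C (κ j * br (a i) (a j)) *
    ∏ k ∈ (Finset.univ.erase j).erase i, linForm (tangentVec N (a k)), ?_, fun j hj => ?_⟩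
  · rw [pencilForm, ← Finset.add_sum_erase _ _ (Finset.mem_univ i), br_self, mul_zero, map_zero,
      zero_mul, zero_add, Finset.mul_sum]
    refine Finset.sum_congr rfl fun j hj => ?_
    have hi : i ∈ Finset.univ.erase j := by simpa using (Finset.ne_of_mem_erase hj).symm
    rw [← Finset.mul_prod_erase _ _ hi]
    ring
  · rw [map_sum, Finset.sum_eq_single j]
    · simp [eval_tangent]
    · intro k hk hkj
      rw [map_mul, eval_prod, Finset.prod_eq_zero (i := j) (by simp [hj, hkj.symm]), mul_zero]
      rw [eval_tangent, br_self, mul_zero]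
    · intro h
      simp [hj] at h

variable {a κ}

lemma prod_br_ne_zero (ha : Pairwise fun i j => br (a i) (a j) ≠ 0) (i : ι) :
    ∏ k ∈ Finset.univ.erase i, br (a k) (a i) ≠ 0 :=
  Finset.prod_ne_zero_iff.mpr fun _ hk => ha (Finset.ne_of_mem_erase hk)

lemma restr_mul_eq {c : ℂ × ℂ} {G H : MvPolynomial (Fin 3) ℂ} (h : pencilForm N a κ c = G * H)
    (i : ι) : restr N (a i) G * restr N (a i) H =
      C (κ i * br c (a i) * ∏ k ∈ Finset.univ.erase i, br (a k) (a i)) *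
        ∏ k ∈ Finset.univ.erase i, brForm (a k) := by
  rw [← map_mul, ← h, restr_pencilForm]

lemma eval_toVec_restr (u w : ℂ × ℂ) (G : MvPolynomial (Fin 3) ℂ) :
    eval (toVec w) (restr N u G) = eval (tangentPt N u w) G := by
  simp [eval_restr, toVec]

lemma restr_coeff_ne_zero (ha : Pairwise fun i j => br (a i) (a j) ≠ 0) (hκ : ∀ i, κ i ≠ 0)
    {c : ℂ × ℂ} (hc : ∀ i, br c (a i) ≠ 0) (i : ι) :
    κ i * br c (a i) * ∏ k ∈ Finset.univ.erase i, br (a k) (a i) ≠ 0 :=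
  mul_ne_zero (mul_ne_zero (hκ i) (hc i)) (prod_br_ne_zero ha i)

lemma restr_eq_of_factor (ha0 : ∀ i, a i ≠ 0) (ha : Pairwise fun i j => br (a i) (a j) ≠ 0)
    (hκ : ∀ i, κ i ≠ 0) {c : ℂ × ℂ} (hc : ∀ i, br c (a i) ≠ 0)
    {G H : MvPolynomial (Fin 3) ℂ} (h : pencilForm N a κ c = G * H) (i : ι) :
    ∃ e : ℂ, e ≠ 0 ∧ restr N (a i) G = C e * ∏ k ∈ Finset.univ.erase i with
      eval (tangentPt N (a i) (a k)) G = 0, brForm (a k) := by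
  have := eq_C_mul_prod_of_mul_eq ha0 ha (restr_coeff_ne_zero ha hκ hc i) (restr_mul_eq N h i)
  simpa only [eval_toVec_restr] using this

lemma pencilForm_ne_zero [Nonempty ι] (ha0 : ∀ i, a i ≠ 0)
    (ha : Pairwise fun i j => br (a i) (a j) ≠ 0)
    (hκ : ∀ i, κ i ≠ 0) {c : ℂ × ℂ} (hc : ∀ i, br c (a i) ≠ 0) : pencilForm N a κ c ≠ 0 := by
  intro h
  obtain ⟨i⟩ := ‹Nonempty ι›
  have h' := restr_pencilForm N a κ c i
  rw [h, map_zero, eq_comm, mul_eq_zero, C_eq_zero] at h'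
  refine h'.elim (restr_coeff_ne_zero ha hκ hc i) fun h' => ?_
  exact Finset.prod_ne_zero_iff.mpr (fun k _ => (prime_brForm (ha0 k)).ne_zero) h'

lemma totalDegree_lt_of_factor [Nonempty ι] (ha0 : ∀ i, a i ≠ 0)
    (ha : Pairwise fun i j => br (a i) (a j) ≠ 0)
    (hκ : ∀ i, κ i ≠ 0) {c : ℂ × ℂ} (hc : ∀ i, br c (a i) ≠ 0)
    {G H : MvPolynomial (Fin 3) ℂ} (h : pencilForm N a κ c = G * H) :
    G.totalDegree < Fintype.card ι := by
  have h0 := pencilForm_ne_zero N ha0 ha hκ hc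
  have hd := (isHomogeneous_pencilForm N a κ c).totalDegree h0
  rw [h] at h0
  rw [h, totalDegree_mul_of_isDomain (left_ne_zero_of_mul h0) (right_ne_zero_of_mul h0)] at hd
  have := Fintype.card_pos (α := ι)
  omega

lemma exists_eval_eq_zero_of_factor [Nonempty ι] (ha0 : ∀ i, a i ≠ 0)
    (ha : Pairwise fun i j => br (a i) (a j) ≠ 0)
    (hκ : ∀ i, κ i ≠ 0) {c : ℂ × ℂ} (hc : ∀ i, br c (a i) ≠ 0)
    {G H : MvPolynomial (Fin 3) ℂ} (h : pencilForm N a κ c = G * H) (hG : ¬ IsUnit G) :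
    ∃ i j, i ≠ j ∧ eval (tangentPt N (a i) (a j)) G = 0 := by
  by_contra! hne
  have hconst : ∀ i x, eval (tangentPt N (a i) x) G = eval 0 G := by
    intro i x
    obtain ⟨e, -, he⟩ := restr_eq_of_factor N ha0 ha hκ hc h i
    rw [Finset.filter_false_of_mem, Finset.prod_empty, mul_one] at he
    · have h0 : tangentPt N (a i) 0 = 0 := by
        simpa using tangentPt_comb N (a i) 0 0 0 0
      rw [← eval_toVec_restr, ← h0, ← eval_toVec_restr, he, eval_C, eval_C]
    · intro k hk
      exact hne i k (Finset.ne_of_mem_erase hk).symm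
  have hGC : G - C (eval 0 G) = 0 := by
    refine eq_zero_of_vanish_tangents N ha0 ha ?_ fun i x => ?_
    · exact (totalDegree_sub_C_le _ _).trans_lt (totalDegree_lt_of_factor N ha0 ha hκ hc h)
    · rw [map_sub, eval_C, hconst, sub_self]
  obtain ⟨i⟩ := ‹Nonempty ι›
  have h0 := pencilForm_ne_zero N ha0 ha hκ hc
  rw [h] at h0
  rw [sub_eq_zero] at hGC
  refine hG ?_
  rw [hGC]
  refine (IsUnit.mk0 _ fun hz => left_ne_zero_of_mul h0 ?_).map C
  rw [hGC, hz, map_zero]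

/-- The members of the pencil have no common factor. -/
lemma not_forall_dvd_pencilForm [Nonempty ι] (ha0 : ∀ i, a i ≠ 0)
    (ha : Pairwise fun i j => br (a i) (a j) ≠ 0)
    (hκ : ∀ i, κ i ≠ 0) {c : ℂ × ℂ} (hc : ∀ i, br c (a i) ≠ 0)
    {G : MvPolynomial (Fin 3) ℂ} (hG : ¬ IsUnit G) : ¬ ∀ x, G ∣ pencilForm N a κ x := by
  intro hdvd
  obtain ⟨H, hH⟩ := hdvd c
  obtain ⟨i, j, hij, hz⟩ := exists_eval_eq_zero_of_factor N ha0 ha hκ hc hH hG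
  obtain ⟨E, hE, hEj⟩ := pencilForm_self N a κ i
  obtain ⟨Q, hQ⟩ := hdvd (a i)
  have hres : restr N (a i) G ≠ 0 := by
    obtain ⟨e, he, hG'⟩ := restr_eq_of_factor N ha0 ha hκ hc hH i
    rw [hG']
    exact mul_ne_zero (by rwa [Ne, C_eq_zero])
      (Finset.prod_ne_zero_iff.mpr fun k _ => (prime_brForm (ha0 k)).ne_zero)
  have hQ0 : restr N (a i) Q = 0 := by
    have := congrArg (restr N (a i)) (hE.symm.trans hQ)
    rw [map_mul, map_mul, restr_tangent, br_self, map_zero, zero_mul, zero_mul, eq_comm,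
      mul_eq_zero] at this
    exact this.resolve_left hres
  obtain ⟨Q, rfl⟩ : linForm (tangentVec N (a i)) ∣ Q := by
    refine linForm_dvd (tangentVec_ne_zero N (ha0 i)) Q fun v hv => ?_
    obtain ⟨x, rfl⟩ := exists_eq_tangentPt N (ha0 i) hv
    rw [← eval_toVec_restr, hQ0, map_zero]
  have hEQ : E = G * Q := by
    refine mul_left_cancel₀ (prime_linForm (tangentVec_ne_zero N (ha0 i))).ne_zero ?_
    rw [← hE, hQ]
    ring
  have := hEj j hij.symm
  rw [hEQ, map_mul, hz, zero_mul, eq_comm] at this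
  refine mul_ne_zero (mul_ne_zero (hκ j) (ha hij)) (Finset.prod_ne_zero_iff.mpr fun k hk => ?_)
    this
  simp only [Finset.mem_erase, Finset.mem_univ, and_true] at hk
  exact mul_ne_zero (ha hk.1) (ha hk.2)

/-- The graph on the given lines whose edges are the intersection points not on `G = 0`. -/
def nonzeroGraph (a : ι → ℂ × ℂ) (G : MvPolynomial (Fin 3) ℂ) : SimpleGraph ι where
  Adj i j := i ≠ j ∧ eval (tangentPt N (a i) (a j)) G ≠ 0
  symm := ⟨fun i j h => ⟨h.1.symm, by rw [tangentPt_comm]; exact h.2⟩⟩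
  loopless := ⟨fun _ h => h.1 rfl⟩

lemma nonzeroGraph_compl (ha0 : ∀ i, a i ≠ 0) (ha : Pairwise fun i j => br (a i) (a j) ≠ 0)
    (hκ : ∀ i, κ i ≠ 0) {c : ℂ × ℂ} (hc : ∀ i, br c (a i) ≠ 0)
    {G H : MvPolynomial (Fin 3) ℂ} (h : pencilForm N a κ c = G * H) :
    (nonzeroGraph N a G)ᶜ = nonzeroGraph N a H := by
  ext i j
  rw [SimpleGraph.compl_adj]
  simp only [nonzeroGraph]
  refine and_congr_right fun hij => ?_
  have hnot := not_eval_eq_zero_and_of_mul_eq ha0 ha (restr_coeff_ne_zero ha hκ hc i)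
    (restr_mul_eq N h i) (k := j) (by simp [hij.symm])
  rw [eval_toVec_restr, eval_toVec_restr] at hnot
  have hor : eval (tangentPt N (a i) (a j)) G = 0 ∨ eval (tangentPt N (a i) (a j)) H = 0 := by
    rw [← mul_eq_zero, ← map_mul, ← h]
    refine eval_pencilForm_of_mem_two N a κ c hij ?_ ?_
    · rw [eval_tangent, br_self, zero_mul]
    · rw [eval_tangent, br_self, mul_zero]
  tauto

/-- Factors of two members of the pencil with the same connected graph are proportional. -/
lemma associated_of_nonzeroGraph_eq [Nonempty ι] (ha0 : ∀ i, a i ≠ 0)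
    (ha : Pairwise fun i j => br (a i) (a j) ≠ 0)
    (hκ : ∀ i, κ i ≠ 0) {c c' : ℂ × ℂ} (hc : ∀ i, br c (a i) ≠ 0) (hc' : ∀ i, br c' (a i) ≠ 0)
    {G H G' H' : MvPolynomial (Fin 3) ℂ} (h : pencilForm N a κ c = G * H)
    (h' : pencilForm N a κ c' = G' * H') (hGG' : nonzeroGraph N a G = nonzeroGraph N a G')
    (hconn : (nonzeroGraph N a G).Preconnected) : G ∣ G' := by
  have hadj : ∀ i j, i ≠ j → (eval (tangentPt N (a i) (a j)) G = 0 ↔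
      eval (tangentPt N (a i) (a j)) G' = 0) := fun i j hij => by
    have := congrArg (fun Γ : SimpleGraph ι => Γ.Adj i j) hGG'
    simp only [nonzeroGraph, eq_iff_iff, hij, Ne, not_false_eq_true, true_and] at this
    exact not_iff_not.mp this
  have hprop : ∀ i, ∃ e : ℂ, restr N (a i) G' = C e * restr N (a i) G := by
    intro i
    obtain ⟨e, he, hG⟩ := restr_eq_of_factor N ha0 ha hκ hc h i
    obtain ⟨e', -, hG'⟩ := restr_eq_of_factor N ha0 ha hκ hc' h' i
    refine ⟨e' * e⁻¹, ?_⟩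
    rw [hG, hG', ← mul_assoc, ← map_mul, inv_mul_cancel_right₀ he]
    congr 2
    refine Finset.filter_congr fun k hk => (hadj i k ?_).symm
    exact (Finset.ne_of_mem_erase hk).symm
  choose e he using hprop
  have hev : ∀ i x, eval (tangentPt N (a i) x) G' = e i * eval (tangentPt N (a i) x) G := by
    intro i x
    rw [← eval_toVec_restr, he, map_mul, eval_C, eval_toVec_restr]
  have hconst : ∀ i j, e i = e j := by
    intro i j
    obtain ⟨p⟩ := hconn i j
    induction p with
    | nil => rfl
    | cons hij _ ih =>
      refine Eq.trans ?_ ih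
      refine mul_right_cancel₀ hij.2 ?_
      rw [← hev, tangentPt_comm, hev]
  obtain ⟨i₀⟩ := id ‹Nonempty ι›
  refine ⟨C (e i₀), ?_⟩
  rw [← sub_eq_zero]
  refine eq_zero_of_vanish_tangents N ha0 ha ?_ fun i x => ?_
  · refine (totalDegree_sub _ _).trans_lt (max_lt ?_ ?_)
    · exact totalDegree_lt_of_factor N ha0 ha hκ hc' h'
    · refine (totalDegree_mul _ _).trans_lt ?_
      rw [totalDegree_C, add_zero]
      exact totalDegree_lt_of_factor N ha0 ha hκ hc h
  · rw [map_sub, map_mul, eval_C, hev, hconst i i₀]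
    ring

theorem exists_irreducible_pencilForm [Nontrivial ι] (ha0 : ∀ i, a i ≠ 0)
    (ha : Pairwise fun i j => br (a i) (a j) ≠ 0) (hκ : ∀ i, κ i ≠ 0) :
    ∃ c, Irreducible (pencilForm N a κ c) := by
  by_contra! hirr
  have hfac : ∀ τ : {τ : ℂ | ∀ i, br (1, τ) (a i) ≠ 0}, ∃ G H : MvPolynomial (Fin 3) ℂ,
      pencilForm N a κ (1, τ.1) = G * H ∧ ¬ IsUnit G ∧ ¬ IsUnit H := by
    intro τ
    have := hirr (1, τ.1)
    rw [irreducible_iff] at this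
    push Not at this
    have hunit : ¬ IsUnit (pencilForm N a κ (1, τ.1)) := by
      intro hu
      obtain ⟨i, j, hij⟩ := exists_pair_ne ι
      refine (hu.map (eval (tangentPt N (a i) (a j)))).ne_zero ?_
      refine eval_pencilForm_of_mem_two N a κ _ hij ?_ ?_
      · rw [eval_tangent, br_self, zero_mul]
      · rw [eval_tangent, br_self, mul_zero]
    exact this hunit
  choose G H hGH hG hH using hfac
  have := (infinite_setOf_br_ne_zero ha0).to_subtype
  obtain ⟨τ, τ', hne, heq⟩ :=
    Finite.exists_ne_map_eq_of_infinite fun τ => nonzeroGraph N a (G τ)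
  have hbr : br (1, τ.1) (1, τ'.1) ≠ 0 := by
    simp only [br, one_mul]
    exact sub_ne_zero.mpr fun h => hne (Subtype.ext h).symm
  have hall : ∀ {g}, g ∣ pencilForm N a κ (1, τ.1) → g ∣ pencilForm N a κ (1, τ'.1) →
      ∀ x, g ∣ pencilForm N a κ x := by
    intro g h h' x
    obtain ⟨α, β, rfl⟩ := exists_comb_of_br_ne_zero hbr x
    rw [pencilForm_comb]
    exact dvd_add (h.mul_left _) (h'.mul_left _)
  rcases (nonzeroGraph N a (G τ)).connected_or_preconnected_compl with hconn | hconn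
  · have hdvd := associated_of_nonzeroGraph_eq N ha0 ha hκ τ.2 τ'.2 (hGH τ) (hGH τ') heq
      hconn.preconnected
    exact not_forall_dvd_pencilForm N ha0 ha hκ τ.2 (hG τ)
      (hall ⟨_, hGH τ⟩ (hdvd.trans ⟨_, hGH τ'⟩))
  · have hcompl := nonzeroGraph_compl N ha0 ha hκ τ.2 (hGH τ)
    have hcompl' := nonzeroGraph_compl N ha0 ha hκ τ'.2 (hGH τ')
    rw [hcompl] at hconn
    have h1 : pencilForm N a κ (1, τ.1) = H τ * G τ := by rw [hGH, mul_comm]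
    have h2 : pencilForm N a κ (1, τ'.1) = H τ' * G τ' := by rw [hGH, mul_comm]
    have heq' : nonzeroGraph N a (H τ) = nonzeroGraph N a (H τ') := by
      rw [← hcompl, ← hcompl']
      exact congrArg _ heq
    have hdvd := associated_of_nonzeroGraph_eq N ha0 ha hκ τ.2 τ'.2 h1 h2 heq' hconn
    exact not_forall_dvd_pencilForm N ha0 ha hκ τ.2 (hH τ) (hall ⟨_, h1⟩ (hdvd.trans ⟨_, h2⟩))

end Pencil

/-- Homogeneous Lagrange interpolation: the divided difference of a binary form of low degree
vanishes. -/
lemma sum_prod_br_div_eq_zero {ι : Type*} [DecidableEq ι] {a : ι → ℂ × ℂ}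
    (ha : Pairwise fun i j => br (a i) (a j) ≠ 0) (x : Multiset (ℂ × ℂ)) {s : Finset ι}
    (hs : s.card = Multiset.card x + 2) :
    ∑ i ∈ s, (x.map fun y => br y (a i)).prod / ∏ k ∈ s.erase i, br (a k) (a i) = 0 := by
  induction x using Multiset.induction_on generalizing s with
  | empty =>
    obtain ⟨p, q, hpq, rfl⟩ := Finset.card_eq_two.mp (by simpa using hs)
    have h1 : ({p, q} : Finset ι).erase p = {q} := by ext; simp; grind
    have h2 : ({p, q} : Finset ι).erase q = {p} := by ext; simp; grind
    rw [Finset.sum_pair hpq, h1, h2]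
    have := ha hpq
    have h3 := br_swap (a p) (a q)
    simp only [Multiset.map_zero, Multiset.prod_zero, Finset.prod_singleton, h3]
    field_simp
    ring
  | cons y x ih =>
    rw [Multiset.card_cons] at hs
    have key : ∀ p ∈ s, ∑ i ∈ s, br (a p) (a i) * ((x.map fun y => br y (a i)).prod /
        ∏ k ∈ s.erase i, br (a k) (a i)) = 0 := by
      intro p hp
      rw [← Finset.add_sum_erase _ _ hp, br_self, zero_mul, zero_add,
        ← ih (s := s.erase p) (by rw [Finset.card_erase_of_mem hp]; omega)]
      refine Finset.sum_congr rfl fun i hi => ?_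
      have hip := Finset.ne_of_mem_erase hi
      rw [← Finset.mul_prod_erase (s.erase i) _ (Finset.mem_erase.mpr ⟨hip.symm, hp⟩),
        Finset.erase_right_comm]
      rw [← mul_div_assoc, mul_div_mul_left _ _ (ha hip.symm)]
    obtain ⟨p, hp, q, hq, hpq⟩ := Finset.one_lt_card.mp (show 1 < s.card by omega)
    obtain ⟨α, β, rfl⟩ := exists_comb_of_br_ne_zero (ha hpq) y
    have hp' := key p hp
    have hq' := key q hq
    simp only [Multiset.map_cons, Multiset.prod_cons, br_comb]
    calc _ = α * ∑ i ∈ s, br (a p) (a i) * ((x.map fun y => br y (a i)).prod /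
              ∏ k ∈ s.erase i, br (a k) (a i)) +
            β * ∑ i ∈ s, br (a q) (a i) * ((x.map fun y => br y (a i)).prod /
              ∏ k ∈ s.erase i, br (a k) (a i)) := by
          rw [Finset.mul_sum, Finset.mul_sum, ← Finset.sum_add_distrib]
          refine Finset.sum_congr rfl fun i _ => ?_
          ring
      _ = 0 := by rw [hp', hq']; ring

section SecondStar

variable {ι σ : Type*} [Fintype ι] [DecidableEq ι] [Fintype σ] [DecidableEq σ]

/-- The coefficients of the pencil passing through the star configuration of the lines `b`. -/
def starCoeff (a : ι → ℂ × ℂ) (b : σ → ℂ × ℂ) (i : ι) : ℂ :=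
  (∏ l, br (b l) (a i)) / ∏ k ∈ Finset.univ.erase i, br (a k) (a i)

lemma eval_pencilForm_starCoeff {a : ι → ℂ × ℂ} {b : σ → ℂ × ℂ}
    (ha : Pairwise fun i j => br (a i) (a j) ≠ 0) (hb0 : ∀ j, b j ≠ 0)
    (hb : Pairwise fun i j => br (b i) (b j) ≠ 0)
    (hcard : Fintype.card ι = Fintype.card σ + 1) (c : ℂ × ℂ) {v : Fin 3 → ℂ} {j k : σ}
    (hjk : j ≠ k) (hj : eval v (linForm (tangentVec N (b j))) = 0)
    (hk : eval v (linForm (tangentVec N (b k))) = 0) :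
    eval v (pencilForm N a (starCoeff a b) c) = 0 := by
  obtain ⟨w, rfl⟩ := exists_eq_tangentPt N (hb0 j) (by rwa [eval_linForm] at hj)
  rw [eval_tangent] at hk
  obtain ⟨μ, rfl⟩ := exists_smul_of_br_eq_zero (hb0 k)
    ((mul_eq_zero.mp hk).resolve_left (hb hjk.symm))
  let x : Multiset (ℂ × ℂ) := c ::ₘ ((Finset.univ.erase j).erase k).val.map b
  have hkj : k ∈ Finset.univ.erase j := by simp [hjk.symm]
  have hx : (Finset.univ : Finset ι).card = Multiset.card x + 2 := by
    have h1 := Finset.card_erase_of_mem hkj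
    have h2 := Finset.card_erase_of_mem (Finset.mem_univ j)
    have h3 : 0 < (Finset.univ.erase j).card := Finset.card_pos.mpr ⟨k, hkj⟩
    rw [Multiset.card_cons, Multiset.card_map, Finset.card_val, Finset.card_univ, hcard,
      ← Finset.card_univ]
    omega
  have hsum := sum_prod_br_div_eq_zero ha x (s := (Finset.univ : Finset ι)) hx
  have hterm : ∀ i, eval (tangentPt N (b j) (μ • b k)) (C (starCoeff a b i * br c (a i)) *
        ∏ l ∈ Finset.univ.erase i, linForm (tangentVec N (a l))) =
      (μ ^ (Fintype.card ι - 1) * ∏ l, br (a l) (b j) * br (a l) (b k)) *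
        ((x.map fun y => br y (a i)).prod / ∏ l ∈ Finset.univ.erase i, br (a l) (a i)) := by
    intro i
    have hμ : ∀ u, br u (μ • b k) = μ * br u (b k) := fun u => by simp [br]; ring
    have hxi : (x.map fun y => br y (a i)).prod =
        br c (a i) * ∏ l ∈ (Finset.univ.erase j).erase k, br (b l) (a i) := by
      simp only [x, Multiset.map_cons, Multiset.prod_cons, Multiset.map_map, Function.comp_def]
      rfl
    rw [hxi, map_mul, eval_C, eval_prod, starCoeff,
      ← Finset.mul_prod_erase Finset.univ (fun l => br (b l) (a i)) (Finset.mem_univ j),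
      ← Finset.mul_prod_erase (Finset.univ.erase j) (fun l => br (b l) (a i)) hkj,
      ← Finset.mul_prod_erase Finset.univ (fun l => br (a l) (b j) * br (a l) (b k))
        (Finset.mem_univ i)]
    simp only [eval_tangent, hμ, mul_left_comm _ μ, Finset.prod_mul_distrib (f := fun _ => μ),
      Finset.prod_const, Finset.card_erase_of_mem (Finset.mem_univ i), Finset.card_univ]
    rw [br_swap (a i) (b j), br_swap (a i) (b k)]
    ring
  rw [pencilForm, map_sum, Finset.sum_congr rfl fun i _ => hterm i, ← Finset.mul_sum, hsum,
    mul_zero]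

end SecondStar

/-! ### Coordinates adapted to a conic -/

lemma exists_coeffs_of_isHomogeneous_two {q : MvPolynomial (Fin 3) ℂ} (hq : q.IsHomogeneous 2) :
    ∃ α β γ δ ε ζ : ℂ, ∀ w, eval w q = α * w 0 ^ 2 + β * w 1 ^ 2 + γ * w 2 ^ 2 +
      δ * (w 0 * w 1) + ε * (w 0 * w 2) + ζ * (w 1 * w 2) := by
  have hmono : ∀ d ∈ q.support, ∃ α β γ δ ε ζ : ℂ, ∀ w : Fin 3 → ℂ,
      q.coeff d * ∏ i, w i ^ d i = α * w 0 ^ 2 + β * w 1 ^ 2 + γ * w 2 ^ 2 +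
        δ * (w 0 * w 1) + ε * (w 0 * w 2) + ζ * (w 1 * w 2) := by
    intro d hd
    have hdeg : d 0 + d 1 + d 2 = 2 := by
      have := hq (mem_support_iff.mp hd)
      rw [Finsupp.weight_apply, Finsupp.sum_fintype _ _ (by simp)] at this
      simpa [Fin.sum_univ_three] using this
    generalize q.coeff d = e
    simp only [Fin.prod_univ_three]
    generalize d 0 = i at *
    generalize d 1 = j at *
    generalize d 2 = k at *
    have hi : i ≤ 2 := by omega
    have hj : j ≤ 2 := by omega
    obtain rfl : k = 2 - i - j := by omega
    interval_cases i <;> interval_cases j <;> simp at hdeg ⊢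
    · exact ⟨0, 0, e, 0, 0, 0, fun w => by ring⟩
    · exact ⟨0, 0, 0, 0, 0, e, fun w => by ring⟩
    · exact ⟨0, e, 0, 0, 0, 0, fun w => by ring⟩
    · exact ⟨0, 0, 0, 0, e, 0, fun w => by ring⟩
    · exact ⟨0, 0, 0, e, 0, 0, fun w => by ring⟩
    · exact ⟨e, 0, 0, 0, 0, 0, fun w => by ring⟩
  choose! α β γ δ ε ζ h using hmono
  refine ⟨∑ d ∈ q.support, α d, ∑ d ∈ q.support, β d, ∑ d ∈ q.support, γ d,
    ∑ d ∈ q.support, δ d, ∑ d ∈ q.support, ε d, ∑ d ∈ q.support, ζ d, fun w => ?_⟩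
  rw [eval_eq', Finset.sum_congr rfl fun d hd => h d hd w]
  simp only [Finset.sum_add_distrib, Finset.sum_mul]

lemma not_irreducible_of_eval_eq_mul {q : MvPolynomial (Fin 3) ℂ}
    (f g : (Fin 3 → ℂ) →ₗ[ℂ] ℂ) (h : ∀ v, eval v q = f v * g v) : ¬ Irreducible q := by
  have hlin : ∀ f : (Fin 3 → ℂ) →ₗ[ℂ] ℂ, ∀ v,
      eval v (linForm fun i => f (Pi.single i 1)) = f v := by
    intro f v
    conv_rhs => rw [pi_eq_sum_univ' v, map_sum]
    simp [eval_linForm, mul_comm]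
  have hq : q = linForm (fun i => f (Pi.single i 1)) * linForm (fun i => g (Pi.single i 1)) :=
    MvPolynomial.funext fun v => by rw [map_mul, hlin, hlin, h]
  rw [hq]
  intro hirr
  exact (hirr.isUnit_or_isUnit rfl).elim (not_isUnit_linForm _) (not_isUnit_linForm _)

lemma exists_factor_binary (A B C : ℂ) : ∃ p q r s : ℂ, ∀ x y : ℂ,
    A * x ^ 2 + B * (x * y) + C * y ^ 2 = (p * x + q * y) * (r * x + s * y) := by
  by_cases hA : A = 0
  · exact ⟨0, 1, B, C, fun x y => by rw [hA]; ring⟩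
  · obtain ⟨d, hd⟩ := IsAlgClosed.exists_eq_mul_self (B ^ 2 - 4 * A * C)
    refine ⟨A, (B + d) / 2, 1, (B - d) / (2 * A), fun x y => ?_⟩
    field_simp
    linear_combination (-y ^ 2) * hd

lemma discrim_eq_zero_of_unique_zero {A B C : ℂ}
    (h : ∀ s t s' t' : ℂ, (s ≠ 0 ∨ t ≠ 0) → (s' ≠ 0 ∨ t' ≠ 0) →
      A * s ^ 2 + B * (s * t) + C * t ^ 2 = 0 → A * s' ^ 2 + B * (s' * t') + C * t' ^ 2 = 0 →
      s * t' = s' * t) : B ^ 2 = 4 * A * C := by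
  by_cases hA : A = 0
  · have : B = 0 := by
      by_contra hB
      have := h 1 0 C (-B) (by simp) (by simp [hB]) (by simp [hA]) (by rw [hA]; ring)
      simp [hB] at this
    rw [hA, this]; ring
  · obtain ⟨d, hd⟩ := IsAlgClosed.exists_eq_mul_self (B ^ 2 - 4 * A * C)
    have := h (-B + d) (2 * A) (-B - d) (2 * A) (by simp [hA]) (by simp [hA])
      (by linear_combination (-A) * hd) (by linear_combination (-A) * hd)
    have hd0 : d = 0 := by
      refine (mul_eq_zero.mp (?_ : (4 * A) * d = 0)).resolve_left (by simp [hA])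
      linear_combination this
    rw [hd0] at hd
    linear_combination hd

/-- On a tangent line, the equation of the conic has at most one zero up to scaling. -/
lemma exists_smul_of_isTangent {q : MvPolynomial (Fin 3) ℂ} (hq : q.IsHomogeneous 2)
    {n : Fin 3 → ℂ} (h : IsTangent {p : P2 | ∑ i, n i * p.rep i = 0} {p : P2 | eval p.rep q = 0})
    {v v' : Fin 3 → ℂ} (hv : v ≠ 0) (hv' : v' ≠ 0) (hn : ∑ i, n i * v i = 0)
    (hn' : ∑ i, n i * v' i = 0) (hqv : eval v q = 0) (hqv' : eval v' q = 0) :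
    ∃ c : ℂ, c • v' = v := by
  obtain ⟨p, hp⟩ := h
  have mem : ∀ {v : Fin 3 → ℂ} (hv : v ≠ 0), ∑ i, n i * v i = 0 → eval v q = 0 →
      Projectivization.mk ℂ v hv = p := by
    intro v hv hn hqv
    rw [← Set.mem_singleton_iff, ← hp]
    obtain ⟨u, hu⟩ := Projectivization.exists_smul_eq_mk_rep ℂ v hv
    obtain ⟨α, β, γ, δ, ε, ζ, hcoef⟩ := exists_coeffs_of_isHomogeneous_two hq
    constructor
    · change ∑ i, n i * _ = 0
      rw [← hu]
      have : ∑ i, n i * (u • v) i = (u : ℂ) * ∑ i, n i * v i := by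
        rw [Finset.mul_sum]
        exact Finset.sum_congr rfl fun i _ => by simp [Units.smul_def]; ring
      rw [this, hn, mul_zero]
    · change eval _ q = 0
      rw [← hu]
      have : eval (u • v) q = (u : ℂ) ^ 2 * eval v q := by
        rw [hcoef, hcoef]
        simp only [Units.smul_def, Pi.smul_apply, smul_eq_mul]
        ring
      rw [this, hqv, mul_zero]
  exact (Projectivization.mk_eq_mk_iff' ℂ v v' hv hv').mp
    ((mem hv hn hqv).trans (mem hv' hn' hqv').symm)

lemma exists_linearEquiv_of_linearIndependent {M : Fin 3 → Fin 3 → ℂ}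
    (hM : LinearIndependent ℂ M) :
    ∃ T : (Fin 3 → ℂ) ≃ₗ[ℂ] (Fin 3 → ℂ), ∀ v k, T v k = ∑ i, M k i * v i := by
  have hunit : IsUnit (Matrix.of M) := Matrix.linearIndependent_rows_iff_isUnit.mp hM
  have := hunit.invertible
  refine ⟨Matrix.toLinearEquiv' (Matrix.of M) this, fun v k => ?_⟩
  change Matrix.toLin' (Matrix.of M) v k = _
  rw [Matrix.toLin'_apply]
  rfl

/-- An irreducible conic with two distinct tangent lines has equation `z² = x y` in suitable
coordinates. -/
lemma exists_conic_coordinates {q : MvPolynomial (Fin 3) ℂ} (hq : q.IsHomogeneous 2)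
    (hirr : Irreducible q) {a b : Fin 3 → ℂ} (hab : LinearIndependent ℂ ![a, b])
    (ha : IsTangent {p : P2 | ∑ i, a i * p.rep i = 0} {p : P2 | eval p.rep q = 0})
    (hb : IsTangent {p : P2 | ∑ i, b i * p.rep i = 0} {p : P2 | eval p.rep q = 0}) :
    ∃ (N : (Fin 3 → ℂ) ≃ₗ[ℂ] (Fin 3 → ℂ)) (e : ℂ), e ≠ 0 ∧
      ∀ v, e * eval v q = N v 2 ^ 2 - N v 0 * N v 1 := by
  obtain ⟨c, hc⟩ := exists_linearIndependent_cons_of_lt_finrank hab (by simp)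
  obtain ⟨T, hT⟩ := exists_linearEquiv_of_linearIndependent hc
  have hT1 : ∀ v, T v 1 = ∑ i, a i * v i := fun v => hT v 1
  have hT2 : ∀ v, T v 2 = ∑ i, b i * v i := fun v => hT v 2
  obtain ⟨α, β, γ, δ, ε, ζ, hcoef⟩ :
      ∃ α β γ δ ε ζ : ℂ, ∀ v, eval v q = α * T v 0 ^ 2 + β * T v 1 ^ 2 + γ * T v 2 ^ 2 +
      δ * (T v 0 * T v 1) + ε * (T v 0 * T v 2) + ζ * (T v 1 * T v 2) := by
    have hq' := hq.aeval (fun k => linForm fun i => T.symm (Pi.single i 1) k)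
      (n := 1) fun k => isHomogeneous_linForm _
    obtain ⟨α, β, γ, δ, ε, ζ, hcoef⟩ := exists_coeffs_of_isHomogeneous_two hq'
    refine ⟨α, β, γ, δ, ε, ζ, fun v => ?_⟩
    rw [← hcoef, eval_aeval]
    congr 2
    ext k
    rw [eval_linForm, ← T.symm_apply_apply v, T.apply_symm_apply]
    conv_lhs => rw [pi_eq_sum_univ' (T v), map_sum]
    simp [mul_comm]
  have hsurj : ∀ x y z, ∃ v, T v 0 = x ∧ T v 1 = y ∧ T v 2 = z := fun x y z =>
    ⟨T.symm ![x, y, z], by simp⟩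
  have hT0 : ∀ v k, T v k ≠ 0 → v ≠ 0 := by
    rintro v k h rfl
    simp at h
  have disc1 : ε ^ 2 = 4 * α * γ := by
    refine discrim_eq_zero_of_unique_zero fun s t s' t' hst hst' h h' => ?_
    obtain ⟨v, h0, h1, h2⟩ := hsurj s 0 t
    obtain ⟨v', h0', h1', h2'⟩ := hsurj s' 0 t'
    have hv : v ≠ 0 := hst.elim (fun h => hT0 v 0 (h0 ▸ h)) fun h => hT0 v 2 (h2 ▸ h)
    have hv' : v' ≠ 0 := hst'.elim (fun h => hT0 v' 0 (h0' ▸ h)) fun h => hT0 v' 2 (h2' ▸ h)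
    obtain ⟨k, rfl⟩ := exists_smul_of_isTangent hq ha hv hv' (by rw [← hT1, h1])
      (by rw [← hT1, h1']) (by rw [hcoef, h0, h1, h2]; linear_combination h)
      (by rw [hcoef, h0', h1', h2']; linear_combination h')
    rw [map_smul] at h0 h2
    rw [← h0, ← h2, ← h0', ← h2']
    simp only [Pi.smul_apply, smul_eq_mul]
    ring
  have disc2 : δ ^ 2 = 4 * α * β := by
    refine discrim_eq_zero_of_unique_zero fun s t s' t' hst hst' h h' => ?_
    obtain ⟨v, h0, h1, h2⟩ := hsurj s t 0
    obtain ⟨v', h0', h1', h2'⟩ := hsurj s' t' 0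
    have hv : v ≠ 0 := hst.elim (fun h => hT0 v 0 (h0 ▸ h)) fun h => hT0 v 1 (h1 ▸ h)
    have hv' : v' ≠ 0 := hst'.elim (fun h => hT0 v' 0 (h0' ▸ h)) fun h => hT0 v' 1 (h1' ▸ h)
    obtain ⟨k, rfl⟩ := exists_smul_of_isTangent hq hb hv hv' (by rw [← hT2, h2])
      (by rw [← hT2, h2']) (by rw [hcoef, h0, h1, h2]; linear_combination h)
      (by rw [hcoef, h0', h1', h2']; linear_combination h')
    rw [map_smul] at h0 h1
    rw [← h0, ← h1, ← h0', ← h1']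
    simp only [Pi.smul_apply, smul_eq_mul]
    ring
  let lin : ℂ → ℂ → ℂ → ((Fin 3 → ℂ) →ₗ[ℂ] ℂ) := fun x y z =>
    (x • LinearMap.proj 0 + y • LinearMap.proj 1 + z • LinearMap.proj 2) ∘ₗ T.toLinearMap
  have hlin : ∀ x y z v, lin x y z v = x * T v 0 + y * T v 1 + z * T v 2 := fun x y z v => by
    simp [lin]
  have hα : α ≠ 0 := by
    rintro rfl
    have hε : ε = 0 := by simpa using disc1
    have hδ : δ = 0 := by simpa using disc2
    obtain ⟨p, u, r, s, hf⟩ := exists_factor_binary β ζ γ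
    refine not_irreducible_of_eval_eq_mul (lin 0 p u) (lin 0 r s) (fun v => ?_) hirr
    rw [hcoef, hlin, hlin, hε, hδ]
    linear_combination hf (T v 1) (T v 2)
  have hsq : ∀ v, 4 * α * eval v q = (2 * α * T v 0 + δ * T v 1 + ε * T v 2) ^ 2 +
      (4 * α * ζ - 2 * δ * ε) * (T v 1 * T v 2) := fun v => by
    rw [hcoef]
    linear_combination (-T v 1 ^ 2) * disc2 - T v 2 ^ 2 * disc1
  have hκ : 4 * α * ζ - 2 * δ * ε ≠ 0 := by
    intro hκ
    refine not_irreducible_of_eval_eq_mul (lin (2 * α) δ ε)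
      ((4 * α)⁻¹ • lin (2 * α) δ ε) (fun v => ?_) hirr
    have := hsq v
    rw [hκ] at this
    rw [LinearMap.smul_apply, hlin, smul_eq_mul]
    field_simp
    linear_combination this
  generalize 4 * α * ζ - 2 * δ * ε = κ at hsq hκ
  let P : Matrix (Fin 3) (Fin 3) ℂ := !![0, 1, 0; 0, 0, -κ; 2 * α, δ, ε]
  have hP : IsUnit P := by
    rw [Matrix.isUnit_iff_isUnit_det]
    simp [P, Matrix.det_fin_three, hα, hκ]
  obtain ⟨S, hS⟩ := exists_linearEquiv_of_linearIndependent
    (Matrix.linearIndependent_rows_iff_isUnit.mpr hP)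
  refine ⟨T.trans S, 4 * α, by simp [hα], fun v => ?_⟩
  simp only [LinearEquiv.trans_apply, hS, hsq, P, Matrix.row, Fin.sum_univ_three]
  simp
  ring

lemma exists_tangentVec_of_isTangent {q : MvPolynomial (Fin 3) ℂ} (hq : q.IsHomogeneous 2)
    {e : ℂ} (he : e ≠ 0) (hN : ∀ v, e * eval v q = N v 2 ^ 2 - N v 0 * N v 1)
    {n : Fin 3 → ℂ} (hn : n ≠ 0)
    (h : IsTangent {p : P2 | ∑ i, n i * p.rep i = 0} {p : P2 | eval p.rep q = 0}) :
    ∃ w : ℂ × ℂ, w ≠ 0 ∧ ∀ v : Fin 3 → ℂ,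
      ∑ i, n i * v i = ∑ i, tangentVec N w i * v i := by
  obtain ⟨A, B, C, hABC⟩ : ∃ A B C : ℂ, ∀ v : Fin 3 → ℂ,
      ∑ i, n i * v i = A * N v 0 + C * N v 1 + B * N v 2 := by
    let f : Fin 3 → ℂ := fun k => ∑ i, n i * N.symm (Pi.single k 1) i
    refine ⟨f 0, f 2, f 1, fun v => ?_⟩
    have hv : ∀ i, v i = ∑ k, N v k * N.symm (Pi.single k 1) i := fun i => by
      conv_lhs => rw [← N.symm_apply_apply v, pi_eq_sum_univ' (N v), map_sum]
      simp [Finset.sum_apply]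
    simp only [f, Fin.sum_univ_three] at hv ⊢
    rw [hv 0, hv 1, hv 2]
    ring
  have disc : B ^ 2 = 4 * A * C := by
    refine discrim_eq_zero_of_unique_zero fun s t s' t' hst hst' h1 h2 => ?_
    let v : ℂ → ℂ → Fin 3 → ℂ := fun s t => N.symm ![s ^ 2, t ^ 2, s * t]
    have hv0 : ∀ s t, s ≠ 0 ∨ t ≠ 0 → v s t ≠ 0 := by
      intro s t hst h0
      have : N (v s t) = 0 := by rw [h0, map_zero]
      rw [N.apply_symm_apply] at this
      have h0 := congrFun this 0
      have h1 := congrFun this 1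
      simp at h0 h1
      tauto
    have hvn : ∀ s t, A * s ^ 2 + B * (s * t) + C * t ^ 2 = 0 → ∑ i, n i * v s t i = 0 := by
      intro s t h0
      rw [hABC, N.apply_symm_apply]
      simp
      linear_combination h0
    have hvq : ∀ s t, eval (v s t) q = 0 := by
      intro s t
      refine (mul_eq_zero.mp ((hN (v s t)).trans ?_)).resolve_left he
      rw [N.apply_symm_apply]
      simp
      ring
    obtain ⟨c, hc⟩ := exists_smul_of_isTangent hq h (hv0 s t hst) (hv0 s' t' hst')
      (hvn s t h1) (hvn s' t' h2) (hvq s t) (hvq s' t')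
    have hc' := congrArg N hc
    rw [map_smul, N.apply_symm_apply, N.apply_symm_apply] at hc'
    have e0 := congrFun hc' 0
    have e1 := congrFun hc' 1
    have e2 := congrFun hc' 2
    simp at e0 e1 e2
    rw [← sub_eq_zero, ← sq_eq_zero_iff]
    linear_combination (-t' ^ 2) * e0 - s' ^ 2 * e1 + 2 * s' * t' * e2
  have hw : ∃ w : ℂ × ℂ, w.1 ^ 2 = A ∧ w.2 ^ 2 = C ∧ -(2 * w.1 * w.2) = B := by
    obtain ⟨x, hx⟩ := IsAlgClosed.exists_eq_mul_self A
    obtain ⟨y, hy⟩ := IsAlgClosed.exists_eq_mul_self C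
    have : (B - 2 * x * y) * (B + 2 * x * y) = 0 := by
      rw [hx, hy] at disc
      linear_combination disc
    rcases mul_eq_zero.mp this with h | h
    · exact ⟨(x, -y), by rw [hx, sq], by rw [hy]; ring, by linear_combination -h⟩
    · exact ⟨(x, y), by rw [hx, sq], by rw [hy, sq], by linear_combination -h⟩
  obtain ⟨w, hA, hC, hB⟩ := hw
  have heq : ∀ v : Fin 3 → ℂ, ∑ i, n i * v i = ∑ i, tangentVec N w i * v i := fun v => by
    rw [hABC, sum_tangentVec, hA, hC, ← hB]
    ring
  refine ⟨w, ?_, heq⟩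
  rintro rfl
  refine hn (funext fun k => ?_)
  have := heq (Pi.single k 1)
  rw [sum_tangentVec] at this
  simpa [Pi.single_apply] using this

/-- Every tangent line to the conic has a parameter. -/
lemma exists_tangent_parameter {q : MvPolynomial (Fin 3) ℂ} (hq : q.IsHomogeneous 2)
    {e : ℂ} (he : e ≠ 0) (hN : ∀ v, e * eval v q = N v 2 ^ 2 - N v 0 * N v 1) {L : Set P2}
    (hL : IsLine L) (h : IsTangent L {p : P2 | eval p.rep q = 0}) :
    ∃ w : ℂ × ℂ, w ≠ 0 ∧ L = {p : P2 | eval p.rep (linForm (tangentVec N w)) = 0} := by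
  obtain ⟨n, hn, rfl⟩ := hL
  obtain ⟨w, hw, hnw⟩ := exists_tangentVec_of_isTangent N hq he hN hn h
  exact ⟨w, hw, by simp only [eval_linForm, hnw]⟩

/-- Distinct tangent lines have independent parameters. -/
lemma br_ne_zero_of_zeroLocus_ne {u w : ℂ × ℂ} (hu : u ≠ 0) (hw : w ≠ 0)
    (h : {p : P2 | eval p.rep (linForm (tangentVec N u)) = 0} ≠
      {p : P2 | eval p.rep (linForm (tangentVec N w)) = 0}) : br u w ≠ 0 := by
  intro hbr
  obtain ⟨c, rfl⟩ := exists_smul_of_br_eq_zero hu hbr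
  have hc : c ≠ 0 := by
    rintro rfl
    simp at hw
  refine h (Set.ext fun p => ?_)
  have : eval p.rep (linForm (tangentVec N (c • u))) =
      c ^ 2 * eval p.rep (linForm (tangentVec N u)) := by
    rw [eval_linForm, eval_linForm, sum_tangentVec, sum_tangentVec]
    simp only [Prod.smul_fst, Prod.smul_snd, smul_eq_mul]
    ring
  simp [this, hc]

lemma linearIndependent_of_zeroLocus_ne {a b : Fin 3 → ℂ} (ha : a ≠ 0) (hb : b ≠ 0)
    (h : {p : P2 | ∑ i, a i * p.rep i = 0} ≠ {p : P2 | ∑ i, b i * p.rep i = 0}) :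
    LinearIndependent ℂ ![a, b] := by
  rw [LinearIndependent.pair_iff' ha]
  rintro k rfl
  have hk : k ≠ 0 := by
    rintro rfl
    simp at hb
  refine h (Set.ext fun p => ?_)
  simp [mul_assoc, ← Finset.mul_sum, hk]

end TangentLines

/-- **Theorem (a): irreducible curve of degree `r−1` through `X ∪ Y`, case `s = r−1`.**
Let `γ` be an irreducible conic, `r ≥ 3`, and `ℓ₁,…,ℓ_r, m₁,…,m_{r−1}` pairwise distinct
lines tangent to `γ`, defining contact star configurations `X` and `Y`.  Then some
irreducible homogeneous form of degree `r−1` vanishes at every point of `X ∪ Y`. -/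
theorem irreducible_form_through_two_contact_stars_sub_one
    (γ : Set P2) (hγ : IsIrredConic γ) (r : ℕ) (hr : 3 ≤ r)
    (ℓ : Fin r → Set P2) (m : Fin (r - 1) → Set P2)
    (hℓline : ∀ i, IsLine (ℓ i)) (hmline : ∀ j, IsLine (m j))
    (hℓtan : ∀ i, IsTangent (ℓ i) γ) (hmtan : ∀ j, IsTangent (m j) γ)
    (hℓinj : Function.Injective ℓ) (hminj : Function.Injective m)
    (hcross : ∀ i j, ℓ i ≠ m j) :
    ∃ F : MvPolynomial (Fin 3) ℂ, F.IsHomogeneous (r - 1) ∧ Irreducible F ∧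
      ∀ p ∈ starConfig ℓ ∪ starConfig m, eval p.rep F = 0 := by
  obtain ⟨q, hq, hirr, rfl⟩ := hγ
  obtain ⟨N, e, he, hN⟩ : ∃ (N : (Fin 3 → ℂ) ≃ₗ[ℂ] (Fin 3 → ℂ)) (e : ℂ), e ≠ 0 ∧
      ∀ v, e * eval v q = N v 2 ^ 2 - N v 0 * N v 1 := by
    have hne := hℓinj.ne (a₁ := ⟨0, by omega⟩) (a₂ := ⟨1, by omega⟩) (by simp)
    obtain ⟨x, hx, hx'⟩ := hℓline ⟨0, by omega⟩
    obtain ⟨y, hy, hy'⟩ := hℓline ⟨1, by omega⟩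
    have hxt := hℓtan ⟨0, by omega⟩
    have hyt := hℓtan ⟨1, by omega⟩
    rw [hx'] at hne hxt
    rw [hy'] at hne hyt
    exact exists_conic_coordinates hq hirr (linearIndependent_of_zeroLocus_ne hx hy hne) hxt hyt
  choose a ha0 haℓ using fun i => exists_tangent_parameter N hq he hN (hℓline i) (hℓtan i)
  choose b hb0 hbm using fun j => exists_tangent_parameter N hq he hN (hmline j) (hmtan j)
  have ha : Pairwise fun i j => br (a i) (a j) ≠ 0 := fun i j hij =>
    br_ne_zero_of_zeroLocus_ne N (ha0 i) (ha0 j) (by rw [← haℓ, ← haℓ]; exact hℓinj.ne hij)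
  have hb : Pairwise fun i j => br (b i) (b j) ≠ 0 := fun i j hij =>
    br_ne_zero_of_zeroLocus_ne N (hb0 i) (hb0 j) (by rw [← hbm, ← hbm]; exact hminj.ne hij)
  have hba : ∀ i j, br (b j) (a i) ≠ 0 := fun i j =>
    br_ne_zero_of_zeroLocus_ne N (hb0 j) (ha0 i)
      (by rw [← haℓ, ← hbm]; exact (hcross i j).symm)
  have hκ : ∀ i, starCoeff a b i ≠ 0 := fun i =>
    div_ne_zero (Finset.prod_ne_zero_iff.mpr fun j _ => hba i j) (prod_br_ne_zero ha i)
  have : Nontrivial (Fin r) := Fin.nontrivial_iff_two_le.mpr (by omega)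
  obtain ⟨c, hc⟩ := exists_irreducible_pencilForm N ha0 ha hκ
  refine ⟨_, by simpa using isHomogeneous_pencilForm N a (starCoeff a b) c, hc, ?_⟩
  rintro p (⟨i, j, hij, hi, hj⟩ | ⟨i, j, hij, hi, hj⟩)
  · rw [haℓ] at hi hj
    exact eval_pencilForm_of_mem_two N a _ c hij hi hj
  · rw [hbm] at hi hj
    exact eval_pencilForm_starCoeff N ha hb0 hb (by simp; omega) c hij hi hj

end
end

section
/- Let γ ⊂ ℙ² be an irreducible conic, let r ≥ 3, and let ℓ₁,…,ℓ_r, m₁,…,m_{r−1} be pairwise distinct lines all tangent to γ. Let X = 𝕊(ℓ₁,…,ℓ_r) and Y = 𝕊(m₁,…,m_{r−1}) be the corresponding contact star configurations on γ. Then X ∪ Y is a complete intersection of type (r−1, r−1): there exist homogeneous forms F, G ∈ ℂ[x,y,z], both of degree r−1, whose common zero locus in ℙ² is exactly X ∪ Y, a set of (r−1)² points. -/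
open MvPolynomial

noncomputable section

/-- The univariate polynomial of degree at most two with coefficient vector `v`. -/
def quadPoly (v : Fin 3 → ℂ) : Polynomial ℂ :=
  Polynomial.C (v 2) * Polynomial.X ^ 2 + Polynomial.C (v 1) * Polynomial.X + Polynomial.C (v 0)

lemma eval_quadPoly (v : Fin 3 → ℂ) (x : ℂ) :
    (quadPoly v).eval x = v 2 * x ^ 2 + v 1 * x + v 0 := by
  simp [quadPoly]

lemma natDegree_quadPoly_le (v : Fin 3 → ℂ) : (quadPoly v).natDegree ≤ 2 :=
  Polynomial.natDegree_quadratic_le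

lemma quadPoly_ne_zero {v : Fin 3 → ℂ} (hv : v ≠ 0) : quadPoly v ≠ 0 := by
  contrapose! hv
  have h (n : ℕ) : (quadPoly v).coeff n = 0 := by simp [hv]
  have h0 := h 0
  have h1 := h 1
  have h2 := h 2
  simp [quadPoly, Polynomial.coeff_X, Polynomial.coeff_C] at h0 h1 h2
  ext i
  fin_cases i <;> simp [h0, h1, h2]

lemma quadPoly_coeff_of_roots {v : Fin 3 → ℂ} {a b : ℂ} (hab : a ≠ b)
    (ha : (quadPoly v).eval a = 0) (hb : (quadPoly v).eval b = 0) :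
    v 1 = -(v 2 * (a + b)) ∧ v 0 = v 2 * (a * b) := by
  rw [eval_quadPoly] at ha hb
  have h1 : v 1 = -(v 2 * (a + b)) := by
    apply mul_left_cancel₀ (sub_ne_zero.2 hab)
    linear_combination ha - hb
  refine ⟨h1, ?_⟩
  rw [h1] at ha
  linear_combination ha

lemma eval_quadPoly_of_roots {v : Fin 3 → ℂ} {a b : ℂ} (hab : a ≠ b)
    (ha : (quadPoly v).eval a = 0) (hb : (quadPoly v).eval b = 0) (x : ℂ) :
    (quadPoly v).eval x = v 2 * ((x - a) * (x - b)) := by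
  obtain ⟨h1, h0⟩ := quadPoly_coeff_of_roots hab ha hb
  rw [eval_quadPoly, h1, h0]
  ring

lemma leadingCoeff_ne_zero_of_roots {v : Fin 3 → ℂ} (hv : v ≠ 0) {a b : ℂ} (hab : a ≠ b)
    (ha : (quadPoly v).eval a = 0) (hb : (quadPoly v).eval b = 0) : v 2 ≠ 0 := by
  obtain ⟨h1, h0⟩ := quadPoly_coeff_of_roots hab ha hb
  intro h2
  apply hv
  ext i
  fin_cases i <;> simp [h0, h1, h2]

section Interpolation

variable {ι κ : Type*} [Fintype ι] [Fintype κ] [DecidableEq ι]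

/-- The weight `∏ⱼ (tᵢ - sⱼ) / ∏_{k ≠ i} (tᵢ - tₖ)`. -/
def crossWeight (t : ι → ℂ) (s : κ → ℂ) (i : ι) : ℂ :=
  (∏ j, (t i - s j)) / ∏ k ∈ Finset.univ.erase i, (t i - t k)

lemma crossWeight_ne_zero {t : ι → ℂ} {s : κ → ℂ} (ht : Function.Injective t)
    (hts : ∀ i j, t i ≠ s j) (i : ι) : crossWeight t s i ≠ 0 := by
  refine div_ne_zero (Finset.prod_ne_zero_iff.2 fun j _ => sub_ne_zero.2 (hts i j))
    (Finset.prod_ne_zero_iff.2 fun k hk => sub_ne_zero.2 fun h => ?_)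
  exact (Finset.mem_erase.1 hk).1 (ht h).symm

/-- The weighted sum over `i` of the products of the `c k` with `k ≠ i`, with weights
`crossWeight t s i * t i ^ e`. -/
def bezoutSum (t : ι → ℂ) (s : κ → ℂ) (e : ℕ) (c : ι → ℂ) : ℂ :=
  ∑ i, crossWeight t s i * t i ^ e * ∏ k ∈ Finset.univ.erase i, c k

lemma bezoutSum_of_eq_zero (t : ι → ℂ) (s : κ → ℂ) (e : ℕ) {c : ι → ℂ} {i : ι} (hi : c i = 0) :
    bezoutSum t s e c = crossWeight t s i * t i ^ e * ∏ k ∈ Finset.univ.erase i, c k := by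
  refine Finset.sum_eq_single i (fun j _ hji => ?_) (by simp)
  rw [Finset.prod_eq_zero (Finset.mem_erase.2 ⟨hji.symm, Finset.mem_univ i⟩) hi, mul_zero]

lemma bezoutSum_of_ne_zero (t : ι → ℂ) (s : κ → ℂ) (e : ℕ) {c : ι → ℂ} (hc : ∀ i, c i ≠ 0) :
    bezoutSum t s e c = (∏ k, c k) * ∑ i, t i ^ e * ((∏ j, (t i - s j)) / c i) /
      ∏ k ∈ Finset.univ.erase i, (t i - t k) := by
  rw [bezoutSum, Finset.mul_sum]
  refine Finset.sum_congr rfl fun i _ => ?_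
  rw [← Finset.mul_prod_erase _ _ (Finset.mem_univ i), crossWeight]
  have := hc i
  field_simp

lemma sum_eval_div_eq_coeff {t : ι → ℂ} (ht : Function.Injective t) {P : Polynomial ℂ}
    (hP : P.degree < Fintype.card ι) :
    ∑ i, P.eval (t i) / ∏ k ∈ Finset.univ.erase i, (t i - t k) =
      P.coeff (Fintype.card ι - 1) :=
  (Lagrange.coeff_eq_sum ht.injOn hP).symm

lemma bezoutSum_eq_zero_of_roots_right {t : ι → ℂ} {s : κ → ℂ} (ht : Function.Injective t)
    (hts : ∀ i j, t i ≠ s j) (hcard : Fintype.card κ + 1 = Fintype.card ι)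
    {v : Fin 3 → ℂ} (hv : v ≠ 0) {a b : κ} (hab : s a ≠ s b)
    (ha : (quadPoly v).eval (s a) = 0) (hb : (quadPoly v).eval (s b) = 0) {e : ℕ} (he : e ≤ 1) :
    bezoutSum t s e (fun i => (quadPoly v).eval (t i)) = 0 := by
  classical
  have h2 := leadingCoeff_ne_zero_of_roots hv hab ha hb
  have hev := eval_quadPoly_of_roots hab ha hb
  have hne : ∀ i, (quadPoly v).eval (t i) ≠ 0 := fun i => by
    rw [hev]
    exact mul_ne_zero h2 (mul_ne_zero (sub_ne_zero.2 (hts i a)) (sub_ne_zero.2 (hts i b)))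
  have hba : b ∈ Finset.univ.erase a :=
    Finset.mem_erase.2 ⟨fun h => hab (by rw [h]), Finset.mem_univ b⟩
  set M : Polynomial ℂ := Polynomial.C (v 2)⁻¹ * (Polynomial.X ^ e *
    ∏ j ∈ (Finset.univ.erase a).erase b, (Polynomial.X - Polynomial.C (s j))) with hM
  have hcard' : ((Finset.univ.erase a).erase b : Finset κ).card + 3 = Fintype.card ι := by
    have h1 := Finset.card_erase_add_one hba
    have h0 := Finset.card_erase_add_one (Finset.mem_univ a)
    rw [Finset.card_univ] at h0
    omega
  have hdeg : M.natDegree < Fintype.card ι - 1 := by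
    refine (Polynomial.natDegree_C_mul_le _ _).trans_lt ?_
    refine Polynomial.natDegree_mul_le.trans_lt ?_
    rw [Polynomial.natDegree_X_pow, Polynomial.natDegree_finsetProd_X_sub_C_eq_card]
    omega
  rw [bezoutSum_of_ne_zero t s e hne]
  have key := sum_eval_div_eq_coeff ht (P := M)
    (Polynomial.degree_le_natDegree.trans_lt (by exact_mod_cast (by omega)))
  rw [Polynomial.coeff_eq_zero_of_natDegree_lt hdeg] at key
  rw [mul_eq_zero]
  right
  rw [← key]
  refine Finset.sum_congr rfl fun i _ => ?_
  congr 1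
  have := hne i
  rw [← Finset.mul_prod_erase _ _ (Finset.mem_univ a), ← Finset.mul_prod_erase _ _ hba, hM]
  simp only [Polynomial.eval_mul, Polynomial.eval_C, Polynomial.eval_pow, Polynomial.eval_X,
    Polynomial.eval_prod, Polynomial.eval_sub]
  rw [hev]
  have h3 := sub_ne_zero.2 (hts i a)
  have h4 := sub_ne_zero.2 (hts i b)
  field_simp

lemma exists_roots_right_of_bezoutSum_eq_zero {t : ι → ℂ} {s : κ → ℂ}
    (ht : Function.Injective t) (hs : Function.Injective s)
    (hcard : Fintype.card κ + 1 = Fintype.card ι) (h3 : 3 ≤ Fintype.card ι)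
    {v : Fin 3 → ℂ} (hne : ∀ i, (quadPoly v).eval (t i) ≠ 0)
    (h0 : bezoutSum t s 0 (fun i => (quadPoly v).eval (t i)) = 0)
    (h1 : bezoutSum t s 1 (fun i => (quadPoly v).eval (t i)) = 0) :
    ∃ a b : κ, a ≠ b ∧ (quadPoly v).eval (s a) = 0 ∧ (quadPoly v).eval (s b) = 0 := by
  classical
  set n := Fintype.card ι with hn
  have hP : ∏ k, (quadPoly v).eval (t k) ≠ 0 := Finset.prod_ne_zero_iff.2 fun k _ => hne k
  rw [bezoutSum_of_ne_zero t s _ hne, mul_eq_zero, or_iff_right hP] at h0 h1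
  set N : Polynomial ℂ := Lagrange.interpolate Finset.univ t
    (fun i => (∏ j, (t i - s j)) / (quadPoly v).eval (t i)) with hN
  have hNeval : ∀ i, N.eval (t i) = (∏ j, (t i - s j)) / (quadPoly v).eval (t i) := fun i =>
    Lagrange.eval_interpolate_at_node _ ht.injOn (Finset.mem_univ i)
  have hNdeg : N.degree < n := Lagrange.degree_interpolate_lt _ ht.injOn
  have hc1 : N.coeff (n - 1) = 0 := by
    rw [← sum_eval_div_eq_coeff ht hNdeg, ← h0]
    exact Finset.sum_congr rfl fun i _ => by rw [hNeval]; simp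
  have hXdeg : (Polynomial.X * N).degree < (n : WithBot ℕ) := by
    rw [Polynomial.degree_lt_iff_coeff_zero] at hNdeg ⊢
    intro m hm
    obtain ⟨k, rfl⟩ : ∃ k, m = k + 1 := ⟨m - 1, by omega⟩
    rw [Polynomial.coeff_X_mul]
    rcases eq_or_ne k (n - 1) with rfl | hk
    · exact hc1
    · exact hNdeg k (by omega)
  have hc2 : N.coeff (n - 2) = 0 := by
    have h := sum_eval_div_eq_coeff ht hXdeg
    rw [show Fintype.card ι - 1 = (n - 2) + 1 by omega, Polynomial.coeff_X_mul] at h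
    rw [← h, ← h1]
    exact Finset.sum_congr rfl fun i _ => by
      rw [Polynomial.eval_mul, hNeval, Polynomial.eval_X, pow_one]
  have hNdeg' : N.degree < (n - 2 : ℕ) := by
    rw [Polynomial.degree_lt_iff_coeff_zero] at hNdeg ⊢
    intro m hm
    rcases eq_or_ne m (n - 1) with rfl | h
    · exact hc1
    rcases eq_or_ne m (n - 2) with rfl | h'
    · exact hc2
    · exact hNdeg m (by omega)
  set g : Polynomial ℂ := ∏ j, (Polynomial.X - Polynomial.C (s j)) with hg
  have hgdeg : g.natDegree = n - 1 := by
    rw [hg, Polynomial.natDegree_finsetProd_X_sub_C_eq_card, Finset.card_univ]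
    omega
  have hg0 : g ≠ 0 := (Polynomial.monic_prod_X_sub_C s Finset.univ).ne_zero
  have hNnat : N.natDegree < n - 2 := by
    rcases eq_or_ne N 0 with h | h
    · rw [h, Polynomial.natDegree_zero]; omega
    · exact (Polynomial.natDegree_lt_iff_degree_lt h).2 hNdeg'
  have hQN : quadPoly v * N = g := by
    refine Polynomial.eq_of_degrees_lt_of_eval_index_eq (v := t) (s := Finset.univ) ht.injOn ?_ ?_ ?_
    · refine Polynomial.degree_le_natDegree.trans_lt ?_
      have := (Polynomial.natDegree_mul_le (p := quadPoly v) (q := N))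
      have := natDegree_quadPoly_le v
      rw [Finset.card_univ]
      exact_mod_cast (by omega)
    · refine Polynomial.degree_le_natDegree.trans_lt ?_
      rw [Finset.card_univ]
      exact_mod_cast (by omega)
    · intro i _
      rw [Polynomial.eval_mul, hNeval, mul_div_cancel₀ _ (hne i), hg]
      simp [Polynomial.eval_prod]
  have hQ2 : (quadPoly v).natDegree = 2 := by
    have h := congrArg Polynomial.natDegree hQN
    have := (Polynomial.natDegree_mul_le (p := quadPoly v) (q := N))
    have := natDegree_quadPoly_le v
    omega
  have hgroots : g.roots = Finset.univ.val.map s := by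
    have h := Polynomial.roots_multiset_prod_X_sub_C (Finset.univ.val.map s)
    rwa [Multiset.map_map] at h
  have hle : (quadPoly v).roots ≤ Finset.univ.val.map s := by
    rw [← hgroots]
    exact Polynomial.roots.le_of_dvd hg0 (hQN ▸ dvd_mul_right _ _)
  have hrc : (quadPoly v).roots.card = 2 := by
    rw [← hQ2]
    exact ((IsAlgClosed.splits (quadPoly v)).natDegree_eq_card_roots).symm
  have hnd : (quadPoly v).roots.Nodup :=
    Multiset.nodup_of_le hle (Multiset.Nodup.map hs Finset.univ.nodup)
  obtain ⟨x, y, hxy⟩ := Multiset.card_eq_two.1 hrc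
  have hx : x ∈ (quadPoly v).roots := by simp [hxy]
  have hy : y ∈ (quadPoly v).roots := by simp [hxy]
  obtain ⟨a, -, rfl⟩ := Multiset.mem_map.1 (Multiset.mem_of_le hle hx)
  obtain ⟨b, -, rfl⟩ := Multiset.mem_map.1 (Multiset.mem_of_le hle hy)
  refine ⟨a, b, ?_, (Polynomial.mem_roots'.1 hx).2, (Polynomial.mem_roots'.1 hy).2⟩
  rintro rfl
  simp [hxy] at hnd

lemma bezoutSum_eq_zero_iff {t : ι → ℂ} {s : κ → ℂ}
    (ht : Function.Injective t) (hs : Function.Injective s) (hts : ∀ i j, t i ≠ s j)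
    (hcard : Fintype.card κ + 1 = Fintype.card ι) (h3 : 3 ≤ Fintype.card ι)
    {v : Fin 3 → ℂ} (hv : v ≠ 0) :
    (bezoutSum t s 0 (fun i => (quadPoly v).eval (t i)) = 0 ∧
      bezoutSum t s 1 (fun i => (quadPoly v).eval (t i)) = 0) ↔
    (∃ i j, i ≠ j ∧ (quadPoly v).eval (t i) = 0 ∧ (quadPoly v).eval (t j) = 0) ∨
      ∃ i j, i ≠ j ∧ (quadPoly v).eval (s i) = 0 ∧ (quadPoly v).eval (s j) = 0 := by
  constructor
  · rintro ⟨h0, h1⟩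
    by_cases hne : ∀ i, (quadPoly v).eval (t i) ≠ 0
    · exact Or.inr (exists_roots_right_of_bezoutSum_eq_zero ht hs hcard h3 hne h0 h1)
    · push Not at hne
      obtain ⟨i, hi⟩ := hne
      rw [bezoutSum_of_eq_zero t s 0 hi, pow_zero, mul_one, mul_eq_zero,
        or_iff_right (crossWeight_ne_zero ht hts i), Finset.prod_eq_zero_iff] at h0
      obtain ⟨j, hj, hj0⟩ := h0
      exact Or.inl ⟨i, j, (Finset.mem_erase.1 hj).1.symm, hi, hj0⟩
  · rintro (⟨i, j, hij, hi, hj⟩ | ⟨a, b, hab, ha, hb⟩)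
    · have hp : ∏ k ∈ Finset.univ.erase i, (quadPoly v).eval (t k) = 0 :=
        Finset.prod_eq_zero (Finset.mem_erase.2 ⟨hij.symm, Finset.mem_univ j⟩) hj
      constructor <;> rw [bezoutSum_of_eq_zero t s _ hi, hp, mul_zero]
    · exact ⟨bezoutSum_eq_zero_of_roots_right ht hts hcard hv (hs.ne hab) ha hb zero_le_one,
        bezoutSum_eq_zero_of_roots_right ht hts hcard hv (hs.ne hab) ha hb le_rfl⟩

end Interpolation

section Conic

lemma mem_line_mk {a : Fin 3 → ℂ} {y : Fin 3 → ℂ} (hy : y ≠ 0) :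
    Projectivization.mk ℂ y hy ∈ {p : P2 | (∑ i, a i * p.rep i) = 0} ↔ ∑ i, a i * y i = 0 := by
  obtain ⟨c, hc⟩ := Projectivization.exists_smul_eq_mk_rep ℂ y hy
  rw [Set.mem_ofPred_eq, ← hc]
  have h : ∑ i, a i * (c • y) i = (c : ℂ) * ∑ i, a i * y i := by
    rw [Finset.mul_sum]
    refine Finset.sum_congr rfl fun i _ => ?_
    rw [Pi.smul_apply, Units.smul_def, smul_eq_mul]
    ring
  rw [h, mul_eq_zero, or_iff_right c.ne_zero]

lemma exists_quadraticForm_of_isHomogeneous {q : MvPolynomial (Fin 3) ℂ}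
    (hq : q.IsHomogeneous 2) : ∃ Q : QuadraticForm ℂ (Fin 3 → ℂ), ∀ x, eval x q = Q x := by
  have key (d : Fin 3 →₀ ℕ) (hd : d ∈ q.support) :
      ∃ Q : QuadraticForm ℂ (Fin 3 → ℂ), ∀ x, q.coeff d * ∏ i, x i ^ d i = Q x := by
    have h2 : d 0 + d 1 + d 2 = 2 := by
      have h := hq (MvPolynomial.mem_support_iff.1 hd)
      rw [Finsupp.weight_apply, Finsupp.sum_fintype _ _ (by simp)] at h
      simpa [Fin.sum_univ_three] using h
    have hab : ∃ a b : Fin 3, ∀ x : Fin 3 → ℂ, ∏ i, x i ^ d i = x a * x b := by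
      simp only [Fin.prod_univ_three]
      have h0 : d 0 ≤ 2 := by omega
      have h1 : d 1 ≤ 2 := by omega
      have e2 : d 2 = 2 - d 0 - d 1 := by omega
      rw [e2]
      generalize d 0 = m at *
      generalize d 1 = n at *
      interval_cases m <;> interval_cases n <;> first
        | omega
        | exact ⟨0, 0, fun x => by ring1⟩
        | exact ⟨0, 1, fun x => by ring1⟩
        | exact ⟨0, 2, fun x => by ring1⟩
        | exact ⟨1, 1, fun x => by ring1⟩
        | exact ⟨1, 2, fun x => by ring1⟩
        | exact ⟨2, 2, fun x => by ring1⟩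
    obtain ⟨a, b, hab⟩ := hab
    exact ⟨q.coeff d • QuadraticMap.proj a b, fun x => by simp [hab]⟩
  choose! Q hQ using key
  refine ⟨∑ d ∈ q.support, Q d, fun x => ?_⟩
  rw [eval_eq', sum_apply]
  exact Finset.sum_congr rfl fun d hd => hQ d hd x

/-- The homogeneous linear polynomial of a linear form. -/
def linPoly (φ : (Fin 3 → ℂ) →ₗ[ℂ] ℂ) : MvPolynomial (Fin 3) ℂ :=
  ∑ i, C (φ (Pi.single i 1)) * X i

lemma eval_linPoly (φ : (Fin 3 → ℂ) →ₗ[ℂ] ℂ) (x : Fin 3 → ℂ) : eval x (linPoly φ) = φ x := by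
  rw [LinearMap.pi_apply_eq_sum_univ φ x]
  simp only [linPoly, map_sum, map_mul, eval_C, eval_X, smul_eq_mul]
  refine Finset.sum_congr rfl fun i _ => ?_
  rw [mul_comm]
  congr 2
  ext j
  simp [Pi.single_apply, eq_comm]

lemma isHomogeneous_linPoly (φ : (Fin 3 → ℂ) →ₗ[ℂ] ℂ) : (linPoly φ).IsHomogeneous 1 :=
  IsHomogeneous.sum _ _ _ fun i _ => by
    simpa using (isHomogeneous_C (Fin 3) (φ (Pi.single i 1))).mul (isHomogeneous_X ℂ i)

lemma not_isUnit_linPoly (φ : (Fin 3 → ℂ) →ₗ[ℂ] ℂ) : ¬IsUnit (linPoly φ) := fun h => by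
  have h0 := h.map (eval (0 : Fin 3 → ℂ))
  rw [eval_linPoly, map_zero] at h0
  exact not_isUnit_zero h0

lemma Irreducible.false_of_eval_eq_mul {q : MvPolynomial (Fin 3) ℂ} (hq : Irreducible q)
    (φ ψ : (Fin 3 → ℂ) →ₗ[ℂ] ℂ) (h : ∀ x, eval x q = φ x * ψ x) : False := by
  have hfac : q = linPoly φ * linPoly ψ := MvPolynomial.funext fun x => by
    rw [h, map_mul, eval_linPoly, eval_linPoly]
  rcases hq.isUnit_or_isUnit hfac with hu | hu
  exacts [not_isUnit_linPoly _ hu, not_isUnit_linPoly _ hu]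

lemma exists_conic_normal_form {q : MvPolynomial (Fin 3) ℂ} (hq : q.IsHomogeneous 2)
    (hirr : Irreducible q) : ∃ T : (Fin 3 → ℂ) ≃ₗ[ℂ] (Fin 3 → ℂ),
      ∀ x, eval x q = T x 0 * T x 2 - T x 1 ^ 2 := by
  obtain ⟨Q, hQ⟩ := exists_quadraticForm_of_isHomogeneous hq
  have hw := Q.equivalent_weightedSumSquares
  rw [Module.finrank_fin_fun] at hw
  obtain ⟨w, ⟨e⟩⟩ := hw
  have ha : ∀ i, ∃ a : ℂ, a ^ 2 = w i := fun i => IsAlgClosed.exists_pow_nat_eq _ two_pos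
  choose a ha using ha
  let z : Fin 3 → (Fin 3 → ℂ) →ₗ[ℂ] ℂ := fun i =>
    a i • (LinearMap.proj i ∘ₗ e.toLinearEquiv.toLinearMap)
  have hz : ∀ i x, z i x = a i * e x i := fun i x => rfl
  have hqz : ∀ x, eval x q = z 0 x ^ 2 + z 1 x ^ 2 + z 2 x ^ 2 := fun x => by
    rw [hQ, ← e.map_app, QuadraticMap.weightedSumSquares_apply, Fin.sum_univ_three]
    simp only [hz, ← ha, smul_eq_mul]
    ring
  have hI := Complex.I_sq
  have ha0 : ∀ i, a i ≠ 0 := by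
    intro i hi
    have hzi : ∀ x, z i x = 0 := fun x => by rw [hz, hi, zero_mul]
    fin_cases i
    · refine hirr.false_of_eval_eq_mul (z 1 + Complex.I • z 2) (z 1 - Complex.I • z 2) fun x => ?_
      have := hzi x
      simp only [Fin.zero_eta] at this
      simp [hqz, this]
      linear_combination z 2 x ^ 2 * hI
    · refine hirr.false_of_eval_eq_mul (z 0 + Complex.I • z 2) (z 0 - Complex.I • z 2) fun x => ?_
      have := hzi x
      simp only [Fin.mk_one] at this
      simp [hqz, this]
      linear_combination z 2 x ^ 2 * hI
    · refine hirr.false_of_eval_eq_mul (z 0 + Complex.I • z 1) (z 0 - Complex.I • z 1) fun x => ?_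
      have := hzi x
      simp only [Fin.reduceFinMk] at this
      simp [hqz, this]
      linear_combination z 1 x ^ 2 * hI
  let T : (Fin 3 → ℂ) →ₗ[ℂ] (Fin 3 → ℂ) :=
    LinearMap.pi ![z 0 + Complex.I • z 1, Complex.I • z 2, z 0 - Complex.I • z 1]
  have hT0 : ∀ x, T x 0 = z 0 x + Complex.I * z 1 x := fun x => rfl
  have hT1 : ∀ x, T x 1 = Complex.I * z 2 x := fun x => rfl
  have hT2 : ∀ x, T x 2 = z 0 x - Complex.I * z 1 x := fun x => rfl
  have hinj : Function.Injective T := by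
    rw [← LinearMap.ker_eq_bot, LinearMap.ker_eq_bot']
    intro x hx
    have h0 : T x 0 = 0 := congrFun hx 0
    have h1 : T x 1 = 0 := congrFun hx 1
    have h2 : T x 2 = 0 := congrFun hx 2
    rw [hT0] at h0
    rw [hT1] at h1
    rw [hT2] at h2
    have z0 : z 0 x = 0 := by linear_combination (h0 + h2) / 2
    have z1 : z 1 x = 0 := by linear_combination (-Complex.I * (h0 - h2)) / 2 + z 1 x * hI
    have z2 : z 2 x = 0 := by linear_combination (-Complex.I * h1) + z 2 x * hI
    rw [hz, mul_eq_zero, or_iff_right (ha0 _)] at z0 z1 z2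
    have hex : e.toLinearEquiv x = 0 := by
      ext i
      fin_cases i
      exacts [z0, z1, z2]
    exact (map_eq_zero_iff _ e.toLinearEquiv.injective).1 hex
  refine ⟨LinearEquiv.ofInjectiveEndo T hinj, fun x => ?_⟩
  rw [LinearEquiv.coe_ofInjectiveEndo, hT0, hT1, hT2, hqz]
  linear_combination (z 1 x ^ 2 + z 2 x ^ 2) * hI

lemma exists_conic_normal_form_generic {q : MvPolynomial (Fin 3) ℂ} (hq : q.IsHomogeneous 2)
    (hirr : Irreducible q) {κ : Type*} [Fintype κ] (P : κ → Fin 3 → ℂ) (hP : ∀ k, P k ≠ 0) :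
    ∃ T : (Fin 3 → ℂ) ≃ₗ[ℂ] (Fin 3 → ℂ),
      (∀ x, eval x q = T x 0 * T x 2 - T x 1 ^ 2) ∧ ∀ k, T (P k) 0 ≠ 0 := by
  obtain ⟨S, hS⟩ := exists_conic_normal_form hq hirr
  have hne : ∏ k, quadPoly ![S (P k) 0, 2 * S (P k) 1, S (P k) 2] ≠ 0 := by
    refine Finset.prod_ne_zero_iff.2 fun k _ => quadPoly_ne_zero fun h => hP k ?_
    have h0 := congrFun h 0
    have h1 := congrFun h 1
    have h2 := congrFun h 2
    refine (map_eq_zero_iff _ S.injective).1 ?_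
    ext i
    fin_cases i
    · simpa using h0
    · simpa using h1
    · simpa using h2
  obtain ⟨c, hc⟩ : ∃ c : ℂ,
      (∏ k, quadPoly ![S (P k) 0, 2 * S (P k) 1, S (P k) 2]).eval c ≠ 0 := by
    by_contra! h
    exact hne (Polynomial.funext fun x => by rw [h, Polynomial.eval_zero])
  rw [Polynomial.eval_prod, Finset.prod_ne_zero_iff] at hc
  let s : Fin 3 → (Fin 3 → ℂ) →ₗ[ℂ] ℂ := fun i => LinearMap.proj i ∘ₗ S.toLinearMap
  let T : (Fin 3 → ℂ) →ₗ[ℂ] (Fin 3 → ℂ) :=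
    LinearMap.pi ![s 0 + (2 * c) • s 1 + (c ^ 2) • s 2, s 1 + c • s 2, s 2]
  have hT0 : ∀ x, T x 0 = S x 0 + 2 * c * S x 1 + c ^ 2 * S x 2 := fun x => rfl
  have hT1 : ∀ x, T x 1 = S x 1 + c * S x 2 := fun x => rfl
  have hT2 : ∀ x, T x 2 = S x 2 := fun x => rfl
  have hinj : Function.Injective T := by
    rw [← LinearMap.ker_eq_bot, LinearMap.ker_eq_bot']
    intro x hx
    have h0 : T x 0 = 0 := congrFun hx 0
    have h1 : T x 1 = 0 := congrFun hx 1
    have h2 : T x 2 = 0 := congrFun hx 2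
    rw [hT0] at h0
    rw [hT1] at h1
    rw [hT2] at h2
    have s1 : S x 1 = 0 := by linear_combination h1 - c * h2
    have s0 : S x 0 = 0 := by linear_combination h0 - 2 * c * s1 - c ^ 2 * h2
    refine (map_eq_zero_iff _ S.injective).1 ?_
    ext i
    fin_cases i
    exacts [s0, s1, h2]
  refine ⟨LinearEquiv.ofInjectiveEndo T hinj, fun x => ?_, fun k => ?_⟩
  · rw [LinearEquiv.coe_ofInjectiveEndo, hT0, hT1, hT2, hS]
    ring
  · have h := hc k (Finset.mem_univ k)
    rw [eval_quadPoly] at h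
    rw [LinearEquiv.coe_ofInjectiveEndo, hT0]
    refine fun hz => h ?_
    simp only [Matrix.cons_val]
    linear_combination hz

/-- The polar form of the conic `u₀u₂ = u₁²`, pulled back along `T`, with respect to `u`. -/
def polarForm (T : (Fin 3 → ℂ) ≃ₗ[ℂ] (Fin 3 → ℂ)) (u : Fin 3 → ℂ) : (Fin 3 → ℂ) →ₗ[ℂ] ℂ :=
  (u 2 • LinearMap.proj 0 - (2 * u 1) • LinearMap.proj 1 + u 0 • LinearMap.proj 2) ∘ₗ
    T.toLinearMap

lemma polarForm_apply (T : (Fin 3 → ℂ) ≃ₗ[ℂ] (Fin 3 → ℂ)) (u x : Fin 3 → ℂ) :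
    polarForm T u x = u 2 * T x 0 - 2 * u 1 * T x 1 + u 0 * T x 2 := rfl

lemma mem_tangent_iff {q : MvPolynomial (Fin 3) ℂ} {T : (Fin 3 → ℂ) ≃ₗ[ℂ] (Fin 3 → ℂ)}
    (hT : ∀ x, eval x q = T x 0 * T x 2 - T x 1 ^ 2) {L : Set P2} (hL : IsLine L) {p : P2}
    (hp : L ∩ {p : P2 | eval p.rep q = 0} = {p}) (hp0 : T p.rep 0 ≠ 0) (r : P2) :
    r ∈ L ↔ polarForm T (T p.rep) r.rep = 0 := by
  obtain ⟨a, -, rfl⟩ := hL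
  have hpmem : p ∈ {p : P2 | (∑ i, a i * p.rep i) = 0} ∩ {p : P2 | eval p.rep q = 0} := by
    rw [hp]; rfl
  obtain ⟨hpL, hpq⟩ := hpmem
  rw [Set.mem_ofPred_eq] at hpL hpq
  rw [hT] at hpq
  set u := p.rep with hu
  set A : (Fin 3 → ℂ) →ₗ[ℂ] ℂ := ∑ i, a i • LinearMap.proj i with hA
  have hAx : ∀ x, A x = ∑ i, a i * x i := fun x => by simp [hA, LinearMap.sum_apply]
  have hker : LinearMap.ker A ≤ LinearMap.ker (polarForm T (T u)) := by
    intro x hx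
    rw [LinearMap.mem_ker] at hx ⊢
    by_contra hb
    set b := polarForm T (T u) x with hbdef
    have hbx : b = _ := polarForm_apply T (T u) x
    set y : Fin 3 → ℂ := (-(eval x q)) • u + b • x with hy
    have hTy : ∀ i, T y i = -(eval x q) * T u i + b * T x i := fun i => by
      rw [hy, map_add, map_smul, map_smul]; rfl
    have hyq : eval y q = 0 := by
      rw [hT, hTy, hTy, hTy]
      have hqx := hT x
      linear_combination (eval x q) ^ 2 * hpq - b ^ 2 * hqx + (eval x q) * b * hbx
    have hyA : A y = 0 := by
      rw [hy, map_add, map_smul, map_smul, hx, hAx, hpL, smul_zero, smul_zero, add_zero]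
    have hyu : ∃ c : ℂ, y = c • u := by
      by_cases hy0 : y = 0
      · exact ⟨0, by rw [hy0, zero_smul]⟩
      · have hmem : Projectivization.mk ℂ y hy0 ∈
            {p : P2 | (∑ i, a i * p.rep i) = 0} ∩ {p : P2 | eval p.rep q = 0} := by
          refine ⟨(mem_line_mk hy0).2 (by rw [← hAx, hyA]), ?_⟩
          obtain ⟨c, hc⟩ := Projectivization.exists_smul_eq_mk_rep ℂ y hy0
          rw [Set.mem_ofPred_eq, ← hc, hT, Units.smul_def, map_smul]
          rw [hT] at hyq
          simp only [Pi.smul_apply, smul_eq_mul]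
          linear_combination (c : ℂ) ^ 2 * hyq
        rw [hp, Set.mem_singleton_iff, ← p.mk_rep, Projectivization.mk_eq_mk_iff'] at hmem
        obtain ⟨c, hc⟩ := hmem
        exact ⟨c, hc.symm⟩
    obtain ⟨c, hc⟩ := hyu
    have hpol : polarForm T (T u) u = 0 := by
      rw [polarForm_apply]
      linear_combination 2 * hpq
    have h1 := congrArg (polarForm T (T u)) hc
    rw [hy, map_add, map_smul, map_smul, map_smul, hpol, ← hbdef, smul_zero, smul_zero,
      zero_add, smul_eq_mul, mul_self_eq_zero] at h1
    exact hb h1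
  have hspan : polarForm T (T u) ∈ Submodule.span ℂ (Set.range fun _ : Unit => A) :=
    mem_span_of_iInf_ker_le_ker ((iInf_const (a := LinearMap.ker A)).trans_le hker)
  rw [Set.range_const, Submodule.mem_span_singleton] at hspan
  obtain ⟨c, hc⟩ := hspan
  have hc0 : c ≠ 0 := by
    rintro rfl
    have h := LinearMap.congr_fun hc (T.symm ![0, 0, 1])
    rw [polarForm_apply] at h
    simp at h
    exact hp0 h.symm
  rw [← hc, LinearMap.smul_apply, smul_eq_mul, mul_eq_zero, or_iff_right hc0, hAx,
    Set.mem_ofPred_eq]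

theorem exists_tangent_coordinates {γ : Set P2} (hγ : IsIrredConic γ) {κ : Type*} [Fintype κ]
    (L : κ → Set P2) (hL : ∀ k, IsLine (L k)) (htan : ∀ k, IsTangent (L k) γ) :
    ∃ (e : (Fin 3 → ℂ) ≃ₗ[ℂ] (Fin 3 → ℂ)) (t : κ → ℂ),
      ∀ k p, p ∈ L k ↔ (quadPoly (e p.rep)).eval (t k) = 0 := by
  obtain ⟨q, hq, hirr, rfl⟩ := hγ
  choose P hP using htan
  obtain ⟨T, hT, hT0⟩ := exists_conic_normal_form_generic hq hirr (fun k => (P k).rep)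
    fun k => (P k).rep_nonzero
  let s : Fin 3 → (Fin 3 → ℂ) →ₗ[ℂ] ℂ := fun i => LinearMap.proj i ∘ₗ T.toLinearMap
  let E : (Fin 3 → ℂ) →ₗ[ℂ] (Fin 3 → ℂ) := LinearMap.pi ![s 2, (-2 : ℂ) • s 1, s 0]
  have hE0 : ∀ x, E x 0 = T x 2 := fun x => rfl
  have hE1 : ∀ x, E x 1 = -2 * T x 1 := fun x => rfl
  have hE2 : ∀ x, E x 2 = T x 0 := fun x => rfl
  have hinj : Function.Injective E := by
    rw [← LinearMap.ker_eq_bot, LinearMap.ker_eq_bot']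
    intro x hx
    have h0 : E x 0 = 0 := congrFun hx 0
    have h1 : E x 1 = 0 := congrFun hx 1
    have h2 : E x 2 = 0 := congrFun hx 2
    rw [hE0] at h0
    rw [hE1] at h1
    rw [hE2] at h2
    have h1' : T x 1 = 0 := by linear_combination -h1 / 2
    refine (map_eq_zero_iff _ T.injective).1 ?_
    ext i
    fin_cases i
    exacts [h2, h1', h0]
  refine ⟨LinearEquiv.ofInjectiveEndo E hinj, fun k => T (P k).rep 1 / T (P k).rep 0,
    fun k p => ?_⟩
  rw [mem_tangent_iff hT (hL k) (hP k) (hT0 k), polarForm_apply, eval_quadPoly,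
    LinearEquiv.coe_ofInjectiveEndo, hE0, hE1, hE2]
  have hk := hT0 k
  have hconic : T (P k).rep 0 * T (P k).rep 2 - T (P k).rep 1 ^ 2 = 0 := by
    rw [← hT]
    exact (show P k ∈ L k ∩ {p : P2 | eval p.rep q = 0} by rw [hP k]; rfl).2
  set u := T (P k).rep
  set v := T p.rep
  have h : u 0 * (v 0 * (u 1 / u 0) ^ 2 + -2 * v 1 * (u 1 / u 0) + v 2) =
      u 2 * v 0 - 2 * u 1 * v 1 + u 0 * v 2 := by
    field_simp
    linear_combination (-v 0) * hconic
  rw [← h, mul_eq_zero, or_iff_right hk]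

end Conic

section PairLocus

variable (e : (Fin 3 → ℂ) ≃ₗ[ℂ] (Fin 3 → ℂ))

/-- The points of the plane whose associated quadratic polynomial has two distinct roots in `S`. -/
def pairLocus (S : Finset ℂ) : Set P2 :=
  {p : P2 | ∃ a ∈ S, ∃ b ∈ S, a ≠ b ∧
    (quadPoly (e p.rep)).eval a = 0 ∧ (quadPoly (e p.rep)).eval b = 0}

lemma map_rep_ne_zero (p : P2) : e p.rep ≠ 0 :=
  (map_ne_zero_iff e e.injective).2 p.rep_nonzero

lemma toFinset_roots_quadPoly {v : Fin 3 → ℂ} (hv : v ≠ 0) {a b : ℂ} (hab : a ≠ b)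
    (ha : (quadPoly v).eval a = 0) (hb : (quadPoly v).eval b = 0) :
    (quadPoly v).roots.toFinset = {a, b} := by
  ext x
  rw [Multiset.mem_toFinset, Polynomial.mem_roots (quadPoly_ne_zero hv), Polynomial.IsRoot.def,
    eval_quadPoly_of_roots hab ha hb, mul_eq_zero,
    or_iff_right (leadingCoeff_ne_zero_of_roots hv hab ha hb), mul_eq_zero, sub_eq_zero,
    sub_eq_zero, Finset.mem_insert, Finset.mem_singleton]

lemma exists_point_of_roots (a b : ℂ) :
    ∃ p : P2, (quadPoly (e p.rep)).eval a = 0 ∧ (quadPoly (e p.rep)).eval b = 0 := by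
  have hv : e.symm ![a * b, -(a + b), 1] ≠ 0 := by
    rw [Ne, map_eq_zero_iff _ e.symm.injective]
    intro h
    simpa using congrFun h 2
  obtain ⟨c, hc⟩ := Projectivization.exists_smul_eq_mk_rep ℂ _ hv
  refine ⟨Projectivization.mk ℂ _ hv, ?_⟩
  rw [← hc, Units.smul_def, map_smul, LinearEquiv.apply_symm_apply, eval_quadPoly, eval_quadPoly]
  simp only [Pi.smul_apply, smul_eq_mul, Matrix.cons_val]
  constructor <;> ring

lemma eq_of_common_roots {p r : P2} {a b : ℂ} (hab : a ≠ b)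
    (hpa : (quadPoly (e p.rep)).eval a = 0) (hpb : (quadPoly (e p.rep)).eval b = 0)
    (hra : (quadPoly (e r.rep)).eval a = 0) (hrb : (quadPoly (e r.rep)).eval b = 0) : p = r := by
  obtain ⟨p1, p0⟩ := quadPoly_coeff_of_roots hab hpa hpb
  obtain ⟨r1, r0⟩ := quadPoly_coeff_of_roots hab hra hrb
  have hr2 := leadingCoeff_ne_zero_of_roots (map_rep_ne_zero e r) hab hra hrb
  rw [← p.mk_rep, ← r.mk_rep, Projectivization.mk_eq_mk_iff']
  refine ⟨e p.rep 2 / e r.rep 2, e.injective ?_⟩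
  rw [map_smul]
  ext i
  rw [Pi.smul_apply, smul_eq_mul]
  fin_cases i
  · simp only [Fin.zero_eta, p0, r0]
    field_simp
  · simp only [Fin.mk_one, p1, r1]
    field_simp
  · simp only [Fin.reduceFinMk]
    field_simp

lemma bijOn_pairLocus (S : Finset ℂ) :
    Set.BijOn (fun p : P2 => (quadPoly (e p.rep)).roots.toFinset) (pairLocus e S)
      (S.powersetCard 2 : Finset (Finset ℂ)) := by
  refine ⟨?_, ?_, ?_⟩
  · rintro p ⟨a, ha, b, hb, hab, hpa, hpb⟩
    simp only [toFinset_roots_quadPoly (map_rep_ne_zero e p) hab hpa hpb, SetLike.mem_coe,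
      Finset.mem_powersetCard, Finset.card_pair hab, and_true]
    exact Finset.insert_subset ha (Finset.singleton_subset_iff.2 hb)
  · rintro p ⟨a, ha, b, hb, hab, hpa, hpb⟩ r - hpr
    have hroot {x : ℂ} (hx : (quadPoly (e p.rep)).eval x = 0) :
        (quadPoly (e r.rep)).eval x = 0 := by
      have hmem : x ∈ (quadPoly (e p.rep)).roots.toFinset := Multiset.mem_toFinset.2
        ((Polynomial.mem_roots (quadPoly_ne_zero (map_rep_ne_zero e p))).2 hx)
      simp only at hpr
      rw [hpr, Multiset.mem_toFinset] at hmem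
      exact (Polynomial.mem_roots'.1 hmem).2
    exact eq_of_common_roots e hab hpa hpb (hroot hpa) (hroot hpb)
  · intro A hA
    obtain ⟨hAS, hA2⟩ := Finset.mem_powersetCard.1 hA
    obtain ⟨a, b, hab, rfl⟩ := Finset.card_eq_two.1 hA2
    obtain ⟨p, hpa, hpb⟩ := exists_point_of_roots e a b
    exact ⟨p, ⟨a, hAS (by simp), b, hAS (by simp), hab, hpa, hpb⟩,
      toFinset_roots_quadPoly (map_rep_ne_zero e p) hab hpa hpb⟩

lemma finite_pairLocus (S : Finset ℂ) : (pairLocus e S).Finite :=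
  (bijOn_pairLocus e S).finite_iff_finite.2 (Finset.finite_toSet _)

lemma ncard_pairLocus (S : Finset ℂ) : (pairLocus e S).ncard = S.card.choose 2 := by
  rw [← (bijOn_pairLocus e S).injOn.ncard_image, (bijOn_pairLocus e S).image_eq,
    Set.ncard_coe_finset, Finset.card_powersetCard]

lemma disjoint_pairLocus {S S' : Finset ℂ} (h : Disjoint S S') :
    Disjoint (pairLocus e S) (pairLocus e S') := by
  rw [Set.disjoint_left]
  rintro p ⟨a, ha, b, hb, hab, hpa, hpb⟩ ⟨c, hc, -, -, -, hpc, -⟩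
  rw [eval_quadPoly_of_roots hab hpa hpb, mul_eq_zero,
    or_iff_right (leadingCoeff_ne_zero_of_roots (map_rep_ne_zero e p) hab hpa hpb), mul_eq_zero,
    sub_eq_zero, sub_eq_zero] at hpc
  rcases hpc with rfl | rfl
  exacts [Finset.disjoint_left.1 h ha hc, Finset.disjoint_left.1 h hb hc]

lemma starConfig_eq_pairLocus {n : ℕ} {L : Fin n → Set P2} {t : Fin n → ℂ}
    (ht : Function.Injective t)
    (hL : ∀ i p, p ∈ L i ↔ (quadPoly (e p.rep)).eval (t i) = 0) :
    starConfig L = pairLocus e (Finset.univ.image t) := by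
  ext p
  constructor
  · rintro ⟨i, j, hij, hi, hj⟩
    exact ⟨t i, Finset.mem_image_of_mem _ (Finset.mem_univ i), t j,
      Finset.mem_image_of_mem _ (Finset.mem_univ j), ht.ne hij, (hL i p).1 hi, (hL j p).1 hj⟩
  · rintro ⟨a, ha, b, hb, hab, hpa, hpb⟩
    obtain ⟨i, -, rfl⟩ := Finset.mem_image.1 ha
    obtain ⟨j, -, rfl⟩ := Finset.mem_image.1 hb
    exact ⟨i, j, fun h => hab (by rw [h]), (hL i p).2 hpa, (hL j p).2 hpb⟩

end PairLocus

section BezoutForm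

variable {ι κ : Type*} [Fintype ι] [Fintype κ] [DecidableEq ι]
  (e : (Fin 3 → ℂ) ≃ₗ[ℂ] (Fin 3 → ℂ))

/-- The linear form sending `x` to the value at `a` of its associated quadratic polynomial. -/
def tangentForm (a : ℂ) : (Fin 3 → ℂ) →ₗ[ℂ] ℂ :=
  (a ^ 2 • LinearMap.proj 2 + a • LinearMap.proj 1 + LinearMap.proj 0) ∘ₗ e.toLinearMap

lemma tangentForm_apply (a : ℂ) (x : Fin 3 → ℂ) :
    tangentForm e a x = (quadPoly (e x)).eval a := by
  rw [eval_quadPoly, mul_comm (e x 2), mul_comm (e x 1)]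
  rfl

/-- The form of degree `card ι - 1` whose values are the sums `bezoutSum`. -/
def bezoutForm (t : ι → ℂ) (s : κ → ℂ) (n : ℕ) : MvPolynomial (Fin 3) ℂ :=
  ∑ i, C (crossWeight t s i * t i ^ n) *
    ∏ k ∈ Finset.univ.erase i, linPoly (tangentForm e (t k))

lemma eval_bezoutForm (t : ι → ℂ) (s : κ → ℂ) (n : ℕ) (x : Fin 3 → ℂ) :
    eval x (bezoutForm e t s n) =
      bezoutSum t s n (fun i => (quadPoly (e x)).eval (t i)) := by
  simp only [bezoutForm, bezoutSum, map_sum, map_mul, map_prod, eval_C, eval_linPoly,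
    tangentForm_apply]

lemma isHomogeneous_bezoutForm (t : ι → ℂ) (s : κ → ℂ) (n : ℕ) :
    (bezoutForm e t s n).IsHomogeneous (Fintype.card ι - 1) := by
  refine IsHomogeneous.sum _ _ _ fun i _ => ?_
  have h := (isHomogeneous_C (Fin 3) (crossWeight t s i * t i ^ n)).mul
    (IsHomogeneous.prod (Finset.univ.erase i) (fun k => linPoly (tangentForm e (t k)))
      (fun _ => 1) fun k _ => isHomogeneous_linPoly _)
  simpa [Finset.card_erase_of_mem] using h

lemma bezoutForm_ne_zero {t : ι → ℂ} {s : κ → ℂ} (ht : Function.Injective t)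
    (hts : ∀ i j, t i ≠ s j) (n : ℕ) {i : ι} (hi : t i ^ n ≠ 0) : bezoutForm e t s n ≠ 0 := by
  intro h
  have hev := eval_bezoutForm e t s n (e.symm ![t i ^ 2, -2 * t i, 1])
  rw [h, map_zero, LinearEquiv.apply_symm_apply] at hev
  have hq (x : ℂ) : (quadPoly ![t i ^ 2, -2 * t i, 1]).eval x = (x - t i) ^ 2 := by
    rw [eval_quadPoly]
    simp only [Matrix.cons_val]
    ring
  simp only [hq] at hev
  rw [bezoutSum_of_eq_zero (i := i) t s n (by simp)] at hev
  refine mul_ne_zero (mul_ne_zero (crossWeight_ne_zero ht hts i) hi)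
    (Finset.prod_ne_zero_iff.2 fun k hk => pow_ne_zero 2 (sub_ne_zero.2 fun hki => ?_)) hev.symm
  exact (Finset.mem_erase.1 hk).1 (ht hki)

end BezoutForm

lemma choose_two_add_choose_two (m : ℕ) : (m + 1).choose 2 + m.choose 2 = m * m := by
  induction m with
  | zero => rfl
  | succ k ih =>
    rw [Nat.choose_succ_succ' (k + 1) 1, Nat.choose_one_right]
    have h := Nat.choose_succ_succ' k 1
    rw [Nat.choose_one_right] at h
    norm_num at h ⊢
    linarith

/-- **Theorem (b): `X ∪ Y` is a complete intersection of type `(r−1, r−1)`.**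
Let `γ` be an irreducible conic, `r ≥ 3`, and `ℓ₁,…,ℓ_r, m₁,…,m_{r−1}` pairwise distinct
lines tangent to `γ`, defining contact star configurations `X` and `Y`.  Then `X ∪ Y` is a
complete intersection of type `(r−1, r−1)`, a set of `(r−1)²` points. -/
theorem two_contact_stars_sub_one_complete_intersection
    (γ : Set P2) (hγ : IsIrredConic γ) (r : ℕ) (hr : 3 ≤ r)
    (ℓ : Fin r → Set P2) (m : Fin (r - 1) → Set P2)
    (hℓline : ∀ i, IsLine (ℓ i)) (hmline : ∀ j, IsLine (m j))
    (hℓtan : ∀ i, IsTangent (ℓ i) γ) (hmtan : ∀ j, IsTangent (m j) γ)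
    (hℓinj : Function.Injective ℓ) (hminj : Function.Injective m)
    (hcross : ∀ i j, ℓ i ≠ m j) :
    IsCI (starConfig ℓ ∪ starConfig m) (r - 1) (r - 1) := by
  obtain ⟨e, u, hu⟩ := exists_tangent_coordinates hγ (Sum.elim ℓ m)
    (Sum.forall.2 ⟨hℓline, hmline⟩) (Sum.forall.2 ⟨hℓtan, hmtan⟩)
  have huL (k k') (h : u k = u k') : Sum.elim ℓ m k = Sum.elim ℓ m k' := by
    ext p
    rw [hu, hu, h]
  set t : Fin r → ℂ := fun i => u (Sum.inl i)
  set s : Fin (r - 1) → ℂ := fun j => u (Sum.inr j)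
  have ht : Function.Injective t := fun i j h => hℓinj (huL _ _ h)
  have hs : Function.Injective s := fun i j h => hminj (huL _ _ h)
  have hts : ∀ i j, t i ≠ s j := fun i j h => hcross i j (huL _ _ h)
  have hX : starConfig ℓ = _ := starConfig_eq_pairLocus e ht fun i => hu (Sum.inl i)
  have hY : starConfig m = _ := starConfig_eq_pairLocus e hs fun j => hu (Sum.inr j)
  have hcard : Fintype.card (Fin (r - 1)) + 1 = Fintype.card (Fin r) := by
    rw [Fintype.card_fin, Fintype.card_fin]; omega
  obtain ⟨i₁, hi₁⟩ : ∃ i, t i ≠ 0 := by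
    by_contra! h
    have := ht ((h ⟨0, by omega⟩).trans (h ⟨1, by omega⟩).symm)
    simp at this
  have hhom (n : ℕ) : (bezoutForm e t s n).IsHomogeneous (r - 1) := by
    simpa using isHomogeneous_bezoutForm e t s n
  refine ⟨bezoutForm e t s 0, bezoutForm e t s 1,
    bezoutForm_ne_zero e ht hts 0 (i := i₁) (by simp),
    bezoutForm_ne_zero e ht hts 1 (i := i₁) (by simpa using hi₁), hhom 0, hhom 1, ?_, ?_⟩
  · ext p
    rw [Set.mem_ofPred_eq, eval_bezoutForm, eval_bezoutForm,
      bezoutSum_eq_zero_iff ht hs hts hcard (by simpa using hr) (map_rep_ne_zero e p)]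
    exact or_congr
      (exists₂_congr fun i j => and_congr_right fun _ =>
        and_congr (hu (Sum.inl i) p).symm (hu (Sum.inl j) p).symm)
      (exists₂_congr fun i j => and_congr_right fun _ =>
        and_congr (hu (Sum.inr i) p).symm (hu (Sum.inr j) p).symm)
  · have hdisj : Disjoint (Finset.univ.image t) (Finset.univ.image s) := by
      rw [Finset.disjoint_left]
      intro x hx hx'
      obtain ⟨i, -, rfl⟩ := Finset.mem_image.1 hx
      obtain ⟨j, -, hj⟩ := Finset.mem_image.1 hx'
      exact hts i j hj.symm
    rw [hX, hY, Set.ncard_union_eq (disjoint_pairLocus e hdisj) (finite_pairLocus e _)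
      (finite_pairLocus e _), ncard_pairLocus, ncard_pairLocus, Finset.card_image_of_injective _ ht,
      Finset.card_image_of_injective _ hs, Finset.card_univ, Finset.card_univ, ← hcard,
      Fintype.card_fin, choose_two_add_choose_two]
end
end
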